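/- Fix ϑ ∈ (0,1) and τ ∈ (0, 1/4). Let β : Σ → ℝ and V = (V₁, V₂) : Σ → ℝ² be ϑ-Hölder functions depending only on the nonpositive coordinates (their values at ω depend only on (ω_k)_{k ≤ 0}), with β satisfying condition (WM_m) for m = 1, 2, 4. For fixed α₀ ∈ ℝ, set X_m(ω) = cos(α₀ + β_m(ω)) V₁(σ^m ω) + sin(α₀ + β_m(ω)) V₂(σ^m ω). For each n set p = ⌊n^τ⌋, q = ⌈(log n)²⌉, k = ⌊n/(p+q)⌋, ξ_j = Σ_{m = jp+jq+1}^{(j+1)p+jq} X_m for 0 ≤ j ≤ k−1, and let F_j be the σ-algebra on Σ generated by the coordinates (ω_l)_{l ≤ jp + jq}. Then there exist constants C > 0 and r ∈ (0,1), independent of n, such that for every n and every 1 ≤ j ≤ k−1, μ-almost surely |E(ξ_j | F_{j−1}) − ∫_Σ ξ_j dμ| ≤ C r^{q} and |E(ξ_j² | F_{j−1}) − ∫_Σ ξ_j² dμ| ≤ C r^{q}, where E(·|·) denotes conditional expectation with respect to μ. -/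

import Mathlib

open MeasureTheory Filter Topology
open scoped ENNReal BoundedContinuousFunction

noncomputable section

/-- Two-sided binary sequence space `Σ = {0,1}^ℤ`. -/
abbrev Seq2 : Type := ℤ → Bool

/-- One-sided binary sequence space `Σ⁺ = {0,1}^ℕ`. -/
abbrev Seq1 : Type := ℕ → Bool

/-- The shift map on two-sided sequences, `(σω)_k = ω_{k+1}`. -/
def shift2 (ω : Seq2) : Seq2 := fun k => ω (k + 1)

/-- The shift map on one-sided sequences, `(σω)_k = ω_{k+1}`. -/
def shift1 (ω : Seq1) : Seq1 := fun k => ω (k + 1)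

/-- Two two-sided sequences agree on all indices `|i| < N`. -/
def Agree2 (N : ℕ) (ω ω' : Seq2) : Prop := ∀ i : ℤ, |i| < (N : ℤ) → ω i = ω' i

/-- Two one-sided sequences agree on all indices `i < N`. -/
def Agree1 (N : ℕ) (ω ω' : Seq1) : Prop := ∀ i : ℕ, i < N → ω i = ω' i

/-- `N`-th variation of a function on the two-sided shift space. -/
def var2 {E : Type*} [SeminormedAddCommGroup E] (f : Seq2 → E) (N : ℕ) : ℝ≥0∞ :=
  ⨆ (ω : Seq2) (ω' : Seq2) (_ : Agree2 N ω ω'), (‖f ω - f ω'‖₊ : ℝ≥0∞)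

/-- `N`-th variation of a function on the one-sided shift space. -/
def var1 {E : Type*} [SeminormedAddCommGroup E] (f : Seq1 → E) (N : ℕ) : ℝ≥0∞ :=
  ⨆ (ω : Seq1) (ω' : Seq1) (_ : Agree1 N ω ω'), (‖f ω - f ω'‖₊ : ℝ≥0∞)

/-- Hölder seminorm `|f|_θ = sup_{N ≥ 1} θ^{-N} var_N f` (two-sided). -/
def hSemi2 {E : Type*} [SeminormedAddCommGroup E] (θ : ℝ) (f : Seq2 → E) : ℝ≥0∞ :=
  ⨆ (N : ℕ) (_ : 1 ≤ N), (ENNReal.ofReal θ)⁻¹ ^ N * var2 f N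

/-- Hölder seminorm `|f|_θ = sup_{N ≥ 1} θ^{-N} var_N f` (one-sided). -/
def hSemi1 {E : Type*} [SeminormedAddCommGroup E] (θ : ℝ) (f : Seq1 → E) : ℝ≥0∞ :=
  ⨆ (N : ℕ) (_ : 1 ≤ N), (ENNReal.ofReal θ)⁻¹ ^ N * var1 f N

/-- Sup norm (two-sided). -/
def supNorm2 {E : Type*} [SeminormedAddCommGroup E] (f : Seq2 → E) : ℝ≥0∞ :=
  ⨆ ω : Seq2, (‖f ω‖₊ : ℝ≥0∞)

/-- Sup norm (one-sided). -/
def supNorm1 {E : Type*} [SeminormedAddCommGroup E] (f : Seq1 → E) : ℝ≥0∞ :=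
  ⨆ ω : Seq1, (‖f ω‖₊ : ℝ≥0∞)

/-- Hölder norm `‖f‖_θ = sup|f| + |f|_θ` (two-sided). -/
def hNorm2 {E : Type*} [SeminormedAddCommGroup E] (θ : ℝ) (f : Seq2 → E) : ℝ≥0∞ :=
  supNorm2 f + hSemi2 θ f

/-- Hölder norm `‖f‖_θ = sup|f| + |f|_θ` (one-sided). -/
def hNorm1 {E : Type*} [SeminormedAddCommGroup E] (θ : ℝ) (f : Seq1 → E) : ℝ≥0∞ :=
  supNorm1 f + hSemi1 θ f

/-- `f` is `θ`-Hölder (two-sided). -/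
def IsHolder2 {E : Type*} [SeminormedAddCommGroup E] (θ : ℝ) (f : Seq2 → E) : Prop :=
  hNorm2 θ f < ⊤

/-- `f` is `θ`-Hölder (one-sided). -/
def IsHolder1 {E : Type*} [SeminormedAddCommGroup E] (θ : ℝ) (f : Seq1 → E) : Prop :=
  hNorm1 θ f < ⊤

/-- `μ` is the Bernoulli (1/2, 1/2) product measure on `{0,1}^ℤ`: it is a probability
measure giving each cylinder determined by finitely many coordinates its natural mass. -/
def IsBernoulli2 (μ : Measure Seq2) : Prop :=
  IsProbabilityMeasure μ ∧
    ∀ (s : Finset ℤ) (x : ℤ → Bool),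
      μ {ω : Seq2 | ∀ i ∈ s, ω i = x i} = (1 / 2 : ℝ≥0∞) ^ s.card

/-- `μ` is the Bernoulli (1/2, 1/2) product measure on `{0,1}^ℕ`. -/
def IsBernoulli1 (μ : Measure Seq1) : Prop :=
  IsProbabilityMeasure μ ∧
    ∀ (s : Finset ℕ) (x : ℕ → Bool),
      μ {ω : Seq1 | ∀ i ∈ s, ω i = x i} = (1 / 2 : ℝ≥0∞) ^ s.card

/-- Birkhoff sums `β_n(ω) = ∑_{j<n} β(σ^j ω)` (two-sided). -/
def bSum2 (β : Seq2 → ℝ) (n : ℕ) (ω : Seq2) : ℝ :=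
  ∑ j ∈ Finset.range n, β (shift2^[j] ω)

/-- Birkhoff sums `β_n(ω) = ∑_{j<n} β(σ^j ω)` (one-sided). -/
def bSum1 (β : Seq1 → ℝ) (n : ℕ) (ω : Seq1) : ℝ :=
  ∑ j ∈ Finset.range n, β (shift1^[j] ω)

/-- Condition (WM_m): the equation `e^{imβ(ω)} A(σω) = ν A(ω)` has only the trivial
solution `ν = 1`, `A` constant, among not-identically-zero `θ`-Hölder functions. -/
def WM2 (θ : ℝ) (β : Seq2 → ℝ) (m : ℕ) : Prop :=
  ∀ (A : Seq2 → ℂ) (ν : ℂ), IsHolder2 θ A → (∃ ω, A ω ≠ 0) →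
    (∀ ω, Complex.exp (Complex.I * (m : ℂ) * (β ω : ℂ)) * A (shift2 ω) = ν * A ω) →
    ν = 1 ∧ ∀ ω ω', A ω = A ω'

/-- Condition (WM_m) for the one-sided shift. -/
def WM1 (θ : ℝ) (β : Seq1 → ℝ) (m : ℕ) : Prop :=
  ∀ (A : Seq1 → ℂ) (ν : ℂ), IsHolder1 θ A → (∃ ω, A ω ≠ 0) →
    (∀ ω, Complex.exp (Complex.I * (m : ℂ) * (β ω : ℂ)) * A (shift1 ω) = ν * A ω) →
    ν = 1 ∧ ∀ ω ω', A ω = A ω'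

/-- Observable in the class `E_{θ,m}` with Fourier coefficient `A`:
`F(ω,s) = A(ω) e^{ims} + conj(A(ω)) e^{-ims}` (a real-valued function viewed in `ℂ`). -/
def obs (m : ℕ) (A : Seq2 → ℂ) (ω : Seq2) (s : ℝ) : ℂ :=
  A ω * Complex.exp (Complex.I * (m : ℂ) * (s : ℂ)) +
    (starRingEnd ℂ) (A ω) * Complex.exp (-(Complex.I * (m : ℂ) * (s : ℂ)))

/-- Normalized Haar (Lebesgue) measure on `𝕋 = ℝ/2πℤ`, realized on the fundamental
domain `(0, 2π]` of the real line. -/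
def haarT : Measure ℝ :=
  (ENNReal.ofReal (2 * Real.pi))⁻¹ • (volume.restrict (Set.Ioc 0 (2 * Real.pi)))

/-- A function on the two-sided shift space depends only on the coordinates `k ≥ 0`. -/
def DependsOnNonneg {α : Type*} (f : Seq2 → α) : Prop :=
  ∀ ω ω' : Seq2, (∀ k : ℤ, 0 ≤ k → ω k = ω' k) → f ω = f ω'

/-- A function on the two-sided shift space depends only on the coordinates `k ≤ 0`. -/
def DependsOnNonpos {α : Type*} (f : Seq2 → α) : Prop :=
  ∀ ω ω' : Seq2, (∀ k : ℤ, k ≤ 0 → ω k = ω' k) → f ω = f ω'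

end

/-- Partial sum `S_n = Σ_{j=1}^n X_j`. -/
noncomputable def Sn (X : ℕ → Seq2 → ℝ) (n : ℕ) (ω : Seq2) : ℝ :=
  ∑ j ∈ Finset.Icc 1 n, X j ω

/-- Block length `p = ⌊n^τ⌋`. -/
noncomputable def blockP (τ : ℝ) (n : ℕ) : ℕ := Nat.floor ((n : ℝ) ^ τ)

/-- Gap length `q = ⌈(log n)²⌉`. -/
noncomputable def blockQ (n : ℕ) : ℕ := Nat.ceil (Real.log n ^ 2)

/-- Number of blocks `k = ⌊n/(p+q)⌋`. -/
noncomputable def blockK (τ : ℝ) (n : ℕ) : ℕ := n / (blockP τ n + blockQ n)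

/-- The `j`-th Bernstein block `ξ_j = Σ_{m=jp+jq+1}^{(j+1)p+jq} X_m`. -/
noncomputable def xiBlock (X : ℕ → Seq2 → ℝ) (τ : ℝ) (n j : ℕ) (ω : Seq2) : ℝ :=
  ∑ m ∈ Finset.Icc (j * blockP τ n + j * blockQ n + 1)
      ((j + 1) * blockP τ n + j * blockQ n), X m ω

/-- The block sum `S̃_n = Σ_{j=0}^{k-1} ξ_j`. -/
noncomputable def Stil (X : ℕ → Seq2 → ℝ) (τ : ℝ) (n : ℕ) (ω : Seq2) : ℝ :=
  ∑ j ∈ Finset.range (blockK τ n), xiBlock X τ n j ω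

/-- `σ_n = (∫ S_n² dμ)^{1/2}`. -/
noncomputable def sigman (μ : MeasureTheory.Measure Seq2) (X : ℕ → Seq2 → ℝ)
    (n : ℕ) : ℝ :=
  Real.sqrt (∫ ω, (Sn X n ω) ^ 2 ∂μ)

/-- The equivariant observable `X_m(ω) = cos(α₀ + β_m(ω)) V₁(σ^m ω) +
sin(α₀ + β_m(ω)) V₂(σ^m ω)`. -/
noncomputable def Xobs (β V₁ V₂ : Seq2 → ℝ) (α₀ : ℝ) (m : ℕ) (ω : Seq2) : ℝ :=
  Real.cos (α₀ + bSum2 β m ω) * V₁ (shift2^[m] ω) +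
    Real.sin (α₀ + bSum2 β m ω) * V₂ (shift2^[m] ω)

/-- The σ-algebra on `Σ` generated by the coordinates `(ω_l)_{l ≤ N}`. -/
def Falg (N : ℤ) : MeasurableSpace Seq2 :=
  MeasurableSpace.comap (fun (ω : Seq2) (l : {l : ℤ // l ≤ N}) => ω l.1) inferInstance


/-! ## One-sided transfer operators -/

/-- Prepend a symbol. -/
def cns (b : Bool) (x : Seq1) : Seq1
  | 0 => b
  | (n + 1) => x n

/-- Hölder bound with constant `K` (including `N = 0`). -/
def Hol {E : Type*} [SeminormedAddCommGroup E] (θ K : ℝ) (f : Seq1 → E) : Prop :=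
  ∀ (N : ℕ) (x y : Seq1), Agree1 N x y → ‖f x - f y‖ ≤ K * θ ^ N

/-- Averaging operator. -/
noncomputable def Pop {E : Type*} [NormedAddCommGroup E] [NormedSpace ℝ E]
    (f : Seq1 → E) (x : Seq1) : E :=
  (1 / 2 : ℝ) • (f (cns false x) + f (cns true x))

/-- Twisted averaging operator. -/
noncomputable def Lop (u : Seq1 → ℂ) (f : Seq1 → ℂ) (x : Seq1) : ℂ :=
  u x * Pop f x

theorem agree_cns {N : ℕ} {x y : Seq1} (h : Agree1 N x y) (b : Bool) :
    Agree1 (N + 1) (cns b x) (cns b y) := by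
  intro i hi
  cases i with
  | zero => rfl
  | succ i => exact h i (by omega)

theorem agree_mono {N M : ℕ} {x y : Seq1} (h : Agree1 N x y) (hM : M ≤ N) :
    Agree1 M x y := fun i hi => h i (by omega)

theorem Pop_bound {E : Type*} [NormedAddCommGroup E] [NormedSpace ℝ E]
    {f : Seq1 → E} {D : ℝ} (h : ∀ x, ‖f x‖ ≤ D) (x : Seq1) : ‖Pop f x‖ ≤ D := by
  unfold Pop
  rw [norm_smul]
  have h1 := norm_add_le (f (cns false x)) (f (cns true x))
  have h2 := h (cns false x)
  have h3 := h (cns true x)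
  norm_num
  linarith

theorem Pop_sub_bound {E : Type*} [NormedAddCommGroup E] [NormedSpace ℝ E]
    {f : Seq1 → E} {D : ℝ} {x y : Seq1}
    (h : ∀ b, ‖f (cns b x) - f (cns b y)‖ ≤ D) : ‖Pop f x - Pop f y‖ ≤ D := by
  unfold Pop
  rw [← smul_sub, norm_smul]
  have h1 := norm_add_le (f (cns false x) - f (cns false y)) (f (cns true x) - f (cns true y))
  have h2 := h false
  have h3 := h true
  rw [add_sub_add_comm]
  norm_num
  linarith

theorem Pop_iter_sub_bound {E : Type*} [NormedAddCommGroup E] [NormedSpace ℝ E]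
    {θ D : ℝ} (p : ℕ) : ∀ {f : Seq1 → E}
    (_ : ∀ N x y, Agree1 (p + N) x y → ‖f x - f y‖ ≤ D * θ ^ N), Hol θ D (Pop^[p] f) := by
  induction p with
  | zero =>
    intro f h N x y hxy
    exact h N x y (by simpa using hxy)
  | succ p ih =>
    intro f h
    rw [Function.iterate_succ_apply]
    apply ih
    intro N x y hxy
    apply Pop_sub_bound
    intro b
    apply h
    have := agree_cns hxy b
    exact agree_mono this (by omega)

theorem Pop_iter_bound {E : Type*} [NormedAddCommGroup E] [NormedSpace ℝ E]
    {D : ℝ} (p : ℕ) : ∀ {f : Seq1 → E} (_ : ∀ x, ‖f x‖ ≤ D), ∀ x, ‖(Pop^[p] f) x‖ ≤ D := by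
  induction p with
  | zero => intro f h; simpa using h
  | succ p ih =>
    intro f h
    rw [Function.iterate_succ_apply]
    exact ih (Pop_bound h)

theorem Lop_bound {u f : Seq1 → ℂ} {D : ℝ} (hu : ∀ x, ‖u x‖ = 1)
    (h : ∀ x, ‖f x‖ ≤ D) (x : Seq1) : ‖Lop u f x‖ ≤ D := by
  unfold Lop
  rw [norm_mul, hu, one_mul]
  exact Pop_bound h x

theorem Lop_iter_bound {u : Seq1 → ℂ} {D : ℝ} (hu : ∀ x, ‖u x‖ = 1) (n : ℕ) :
    ∀ {f : Seq1 → ℂ} (_ : ∀ x, ‖f x‖ ≤ D), ∀ x, ‖((Lop u)^[n] f) x‖ ≤ D := by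
  induction n with
  | zero => intro f h; simpa using h
  | succ p ih =>
    intro f h
    rw [Function.iterate_succ_apply]
    exact ih (Lop_bound hu h)

/-- Lasota--Yorke. -/
theorem Lop_hol {θ U : ℝ} {u f : Seq1 → ℂ} {D S : ℝ} (hu : ∀ x, ‖u x‖ = 1)
    (hθ : 0 < θ) (hU : Hol θ U u)
    (h : ∀ x, ‖f x‖ ≤ S) (hf : Hol θ D f) : Hol θ (θ * D + U * S) (Lop u f) := by
  intro N x y hxy
  have e : Lop u f x - Lop u f y = u x * (Pop f x - Pop f y) + (u x - u y) * Pop f y := by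
    unfold Lop; ring
  rw [e]
  have h1 : ‖Pop f x - Pop f y‖ ≤ D * θ ^ (N + 1) :=
    Pop_sub_bound (fun b => hf _ _ _ (agree_cns hxy b))
  have h2 := hU N x y hxy
  have h3 := Pop_bound h y
  calc _ ≤ ‖u x * (Pop f x - Pop f y)‖ + ‖(u x - u y) * Pop f y‖ := norm_add_le _ _
    _ = ‖Pop f x - Pop f y‖ + ‖u x - u y‖ * ‖Pop f y‖ := by
        rw [norm_mul, norm_mul, hu, one_mul]
    _ ≤ D * θ ^ (N + 1) + (U * θ ^ N) * S := by
        gcongr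
        exact (norm_nonneg _).trans h2
    _ = _ := by ring

theorem Lop_smul (u f : Seq1 → ℂ) (c : ℂ) :
    Lop u (fun x => c * f x) = fun x => c * Lop u f x := by
  funext x
  simp only [Lop, Pop, Complex.real_smul]
  ring

theorem Lop_iter_smul (u : Seq1 → ℂ) (c : ℂ) (n : ℕ) : ∀ f : Seq1 → ℂ,
    (Lop u)^[n] (fun x => c * f x) = fun x => c * ((Lop u)^[n] f) x := by
  induction n with
  | zero => intro f; rfl
  | succ n ih => intro f; rw [Function.iterate_succ_apply, Lop_smul, ih]; rfl

/-- A single point carries at least weight `2^{-k}`. -/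
theorem Lop_point {u : Seq1 → ℂ} (hu : ∀ x, ‖u x‖ = 1) {g : Seq1 → ℂ} {a : ℝ}
    (hg : ∀ x, ‖g x‖ ≤ a) (z : Seq1) (k : ℕ) : ∀ x : Seq1, (∀ i, z (i + k) = x i) →
    ‖((Lop u)^[k] g) x‖ ≤ (1 - (1 / 2) ^ k) * a + (1 / 2) ^ k * ‖g z‖ := by
  induction k with
  | zero =>
    intro x hx
    have : z = x := funext hx
    subst this
    simp
  | succ k ih =>
    intro x hx
    have h1 := ih (cns (z k) x) (by
      intro i
      cases i with
      | zero => simp [cns]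
      | succ i =>
        have := hx i
        rw [show i + 1 + k = i + (k + 1) by ring]
        exact this)
    rw [Function.iterate_succ_apply']
    set F := (Lop u)^[k] g with hF
    have hb : ∀ x, ‖F x‖ ≤ a := Lop_iter_bound hu k hg
    have h2 : ‖Lop u F x‖ ≤ (1 / 2) * (‖F (cns false x)‖ + ‖F (cns true x)‖) := by
      unfold Lop Pop
      rw [norm_mul, hu, one_mul, norm_smul]
      have := norm_add_le (F (cns false x)) (F (cns true x))
      norm_num
      linarith
    have h3 : ‖F (cns false x)‖ + ‖F (cns true x)‖ ≤ ‖F (cns (z k) x)‖ + a := by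
      cases z k
      · linarith [hb (cns true x)]
      · linarith [hb (cns false x)]
    calc _ ≤ (1 / 2) * (((1 - (1 / 2) ^ k) * a + (1 / 2) ^ k * ‖g z‖) + a) := by linarith
      _ = _ := by ring

theorem ultra_lim (a : ℕ → ℂ) (C : ℝ) (h : ∀ n, ‖a n‖ ≤ C) :
    ∃ l, Tendsto a (hyperfilter ℕ : Filter ℕ) (𝓝 l) := by
  have hc : IsCompact (Metric.closedBall (0 : ℂ) C) := isCompact_closedBall _ _
  obtain ⟨l, _, hl⟩ := hc.ultrafilter_le_nhds ((hyperfilter ℕ).map a) (by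
    rw [Ultrafilter.coe_map, le_principal_iff, mem_map]
    exact Eventually.of_forall (fun n => by simpa using h n))
  exact ⟨l, hl⟩

theorem hyper_le : (hyperfilter ℕ : Filter ℕ) ≤ atTop := by
  rw [← Nat.cofinite_eq_atTop]
  exact hyperfilter_le_cofinite

theorem hol_lim {θ K : ℝ} {F : ℕ → Seq1 → ℂ} {G : Seq1 → ℂ}
    (hF : ∀ n, Hol θ K (F n))
    (h : ∀ x, Tendsto (fun n => F n x) (hyperfilter ℕ : Filter ℕ) (𝓝 (G x))) :
    Hol θ K G := by
  intro N x y hxy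
  exact le_of_tendsto ((h x).sub (h y)).norm (Eventually.of_forall fun n => hF n N x y hxy)

theorem lop_lim {u : Seq1 → ℂ} {F F' : ℕ → Seq1 → ℂ} {G G' : Seq1 → ℂ}
    (hF : ∀ᶠ n in (hyperfilter ℕ : Filter ℕ), Lop u (F n) = F' n)
    (h : ∀ x, Tendsto (fun n => F n x) (hyperfilter ℕ : Filter ℕ) (𝓝 (G x)))
    (h' : ∀ x, Tendsto (fun n => F' n x) (hyperfilter ℕ : Filter ℕ) (𝓝 (G' x))) :
    Lop u G = G' := by
  funext x
  refine tendsto_nhds_unique ?_ (h' x)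
  have : Tendsto (fun n => Lop u (F n) x) (hyperfilter ℕ : Filter ℕ) (𝓝 (Lop u G x)) := by
    unfold Lop Pop
    exact (((h _).add (h _)).const_smul _).const_mul _
  refine this.congr' ?_
  filter_upwards [hF] with n hn
  rw [hn]

theorem half_eq {a b : ℂ} {c : ℝ} (ha : ‖a‖ ≤ c) (hb : ‖b‖ ≤ c)
    (h : ‖(1 / 2 : ℝ) • (a + b)‖ = c) : a = b := by
  have h1 : ‖a + b‖ = 2 * c := by
    rw [norm_smul] at h; norm_num at h; linarith
  have h2 := parallelogram_law_with_norm ℝ a b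
  have h3 : ‖a - b‖ * ‖a - b‖ ≤ 0 := by
    rw [h1] at h2
    nlinarith [norm_nonneg a, norm_nonneg b]
  have h4 : ‖a - b‖ = 0 := by nlinarith [norm_nonneg (a - b)]
  exact sub_eq_zero.mp (norm_eq_zero.mp h4)


theorem peripheral {θ K ε : ℝ} (hθ : θ ∈ Set.Ioo (0 : ℝ) 1) {u : Seq1 → ℂ}
    (hu : ∀ x, ‖u x‖ = 1)
    (hB : ∀ f : Seq1 → ℂ, (∀ x, ‖f x‖ ≤ 1) → Hol θ K f → Hol θ K (Lop u f))
    (hε : 0 < ε)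
    (hbad : ∀ n, ∃ f : Seq1 → ℂ, (∀ x, ‖f x‖ ≤ 1) ∧ Hol θ K f ∧
      ∃ x, ε ≤ ‖((Lop u)^[n] f) x‖) :
    ∃ (H : Seq1 → ℂ) (c : ℝ) (ν : ℂ), 0 < c ∧ Hol θ K H ∧ (∀ x, ‖H x‖ = c) ∧
      ∀ b x, u x * H (cns b x) = ν * H x := by
  have hBn : ∀ n (f : Seq1 → ℂ), (∀ x, ‖f x‖ ≤ 1) → Hol θ K f → Hol θ K ((Lop u)^[n] f) := by
    intro n
    induction n with
    | zero => intro f _ h; exact h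
    | succ n ih =>
      intro f h1 h2
      rw [Function.iterate_succ_apply]
      exact ih _ (Lop_bound hu h1) (hB f h1 h2)
  let T : ℕ → Set ℝ := fun n => {t | ∃ f : Seq1 → ℂ, (∀ x, ‖f x‖ ≤ 1) ∧ Hol θ K f ∧
      ∃ x, t = ‖((Lop u)^[n] f) x‖}
  have hTbdd : ∀ n, BddAbove (T n) := by
    intro n
    refine ⟨1, ?_⟩
    rintro t ⟨f, h1, _, x, rfl⟩
    exact Lop_iter_bound hu n h1 x
  let c : ℕ → ℝ := fun n => sSup (T n)
  have hle : ∀ n (f : Seq1 → ℂ), (∀ x, ‖f x‖ ≤ 1) → Hol θ K f → ∀ x,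
      ‖((Lop u)^[n] f) x‖ ≤ c n := by
    intro n f h1 h2 x
    exact le_csSup (hTbdd n) ⟨f, h1, h2, x, rfl⟩
  have hTne : ∀ n, (T n).Nonempty := by
    intro n
    obtain ⟨f, h1, h2, x, _⟩ := hbad n
    exact ⟨_, f, h1, h2, x, rfl⟩
  have hcε : ∀ n, ε ≤ c n := by
    intro n
    obtain ⟨f, h1, h2, x, hx⟩ := hbad n
    exact hx.trans (hle n f h1 h2 x)
  have hanti : Antitone c := by
    apply antitone_nat_of_succ_le
    intro n
    apply csSup_le (hTne _)
    rintro t ⟨f, h1, h2, x, rfl⟩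
    rw [Function.iterate_succ_apply]
    exact hle n _ (Lop_bound hu h1) (hB f h1 h2) x
  obtain ⟨c₀, hc₀⟩ : ∃ c₀, Tendsto c atTop (𝓝 c₀) :=
    ⟨_, tendsto_atTop_ciInf hanti ⟨ε, by rintro _ ⟨n, rfl⟩; exact hcε n⟩⟩
  have hc₀ε : ε ≤ c₀ := ge_of_tendsto' hc₀ hcε
  have hc₀le : ∀ n, c₀ ≤ c n := hanti.le_of_tendsto hc₀
  have hex : ∀ n : ℕ, ∃ f : Seq1 → ℂ, (∀ x, ‖f x‖ ≤ 1) ∧ Hol θ K f ∧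
      ∃ x, c₀ - 1 / ((n : ℝ) + 1) ≤ ‖((Lop u)^[n] f) x‖ := by
    intro n
    have : c n - 1 / ((n : ℝ) + 1) < sSup (T n) := by
      have : 0 < 1 / ((n : ℝ) + 1) := by positivity
      change c n - _ < c n
      linarith
    obtain ⟨t, ⟨f, h1, h2, x, rfl⟩, ht⟩ := exists_lt_of_lt_csSup (hTne n) this
    exact ⟨f, h1, h2, x, by linarith [hc₀le n]⟩
  choose f hf1 hfH ξ hξ using hex
  -- first limit
  have hG : ∀ (k : ℕ) (x : Seq1), ∃ l, Tendsto (fun n => ((Lop u)^[n - k] (f n)) x)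
      (hyperfilter ℕ : Filter ℕ) (𝓝 l) := by
    intro k x
    exact ultra_lim _ 1 (fun n => Lop_iter_bound hu _ (hf1 n) x)
  choose G hGlim using hG
  have hGhol : ∀ k, Hol θ K (G k) := fun k =>
    hol_lim (fun n => hBn (n - k) (f n) (hf1 n) (hfH n)) (hGlim k)
  have hGL : ∀ k, Lop u (G (k + 1)) = G k := by
    intro k
    refine lop_lim ?_ (hGlim (k + 1)) (hGlim k)
    apply hyper_le
    filter_upwards [eventually_ge_atTop (k + 1)] with n hn
    rw [← Function.iterate_succ_apply' (Lop u)]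
    congr 2
    omega
  have hcshift : ∀ k, Tendsto (fun n => c (n - k)) (hyperfilter ℕ : Filter ℕ) (𝓝 c₀) := by
    intro k
    exact (hc₀.comp (tendsto_sub_atTop_nat k)).mono_left hyper_le
  have hGle : ∀ k x, ‖G k x‖ ≤ c₀ := by
    intro k x
    exact le_of_tendsto_of_tendsto (hGlim k x).norm (hcshift k)
      (Eventually.of_forall fun n => hle _ _ (hf1 n) (hfH n) x)
  have hGge : ∀ k x, c₀ - K * θ ^ k ≤ ‖G k x‖ := by
    intro k y
    have key : ∀ᶠ n : ℕ in (hyperfilter ℕ : Filter ℕ), c₀ - 1 / ((n : ℝ) + 1) ≤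
        (1 - (1 / 2) ^ k) * c (n - k) +
          (1 / 2) ^ k * (‖((Lop u)^[n - k] (f n)) y‖ + K * θ ^ k) := by
      apply hyper_le
      filter_upwards [eventually_ge_atTop k] with n hn
      let z : Seq1 := fun i => if i < k then y i else ξ n (i - k)
      have h1 := Lop_point hu (hle (n - k) (f n) (hf1 n) (hfH n)) z k (ξ n) (by
        intro i; simp [z])
      rw [← Function.iterate_add_apply, show k + (n - k) = n by omega] at h1
      have h2 : ‖((Lop u)^[n - k] (f n)) z‖ ≤ ‖((Lop u)^[n - k] (f n)) y‖ + K * θ ^ k := by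
        have h3 := hBn (n - k) (f n) (hf1 n) (hfH n) k z y (by
          intro i hi; simp [z, hi])
        have := norm_sub_norm_le (((Lop u)^[n - k] (f n)) z) (((Lop u)^[n - k] (f n)) y)
        linarith
      have h4 : (0 : ℝ) ≤ (1 / 2) ^ k := by positivity
      have := mul_le_mul_of_nonneg_left h2 h4
      linarith [hξ n]
    have l1 : Tendsto (fun n : ℕ => c₀ - 1 / ((n : ℝ) + 1)) (hyperfilter ℕ : Filter ℕ)
        (𝓝 (c₀ - 0)) :=
      (tendsto_const_nhds.sub tendsto_one_div_add_atTop_nhds_zero_nat).mono_left hyper_le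
    have l2 := ((hcshift k).const_mul (1 - (1 / 2) ^ k)).add
      ((((hGlim k y).norm).add_const (K * θ ^ k)).const_mul ((1 / 2 : ℝ) ^ k))
    have h := le_of_tendsto_of_tendsto l1 l2 key
    have h4 : (0 : ℝ) < (1 / 2) ^ k := by positivity
    have h5 : (1 / 2 : ℝ) ^ k * c₀ ≤ (1 / 2) ^ k * (‖G k y‖ + K * θ ^ k) := by linarith
    have := le_of_mul_le_mul_left h5 h4
    linarith
  -- second limit
  have hH : ∀ (k : ℕ) (x : Seq1), ∃ l, Tendsto (fun n => G (k + n) x)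
      (hyperfilter ℕ : Filter ℕ) (𝓝 l) := by
    intro k x
    exact ultra_lim _ c₀ (fun n => hGle _ x)
  choose H hHlim using hH
  have hHhol : ∀ k, Hol θ K (H k) := fun k => hol_lim (fun n => hGhol (k + n)) (hHlim k)
  have hHL : ∀ k, Lop u (H (k + 1)) = H k := by
    intro k
    refine lop_lim ?_ (hHlim (k + 1)) (hHlim k)
    refine Eventually.of_forall fun n => ?_
    rw [show k + 1 + n = k + n + 1 by ring, hGL]
  have hθt : Tendsto (fun n : ℕ => K * θ ^ n) atTop (𝓝 0) := by
    simpa using (tendsto_pow_atTop_nhds_zero_of_lt_one hθ.1.le hθ.2).const_mul K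
  have hHc : ∀ k x, ‖H k x‖ = c₀ := by
    intro k x
    apply le_antisymm
    · exact le_of_tendsto (hHlim k x).norm (Eventually.of_forall fun n => hGle _ x)
    · have l1 : Tendsto (fun n : ℕ => c₀ - K * θ ^ (k + n)) atTop (𝓝 (c₀ - 0)) := by
        apply tendsto_const_nhds.sub
        have := hθt.comp (tendsto_add_atTop_nat k)
        simpa [Function.comp_def, add_comm] using this
      have := le_of_tendsto_of_tendsto (l1.mono_left hyper_le) (hHlim k x).norm
        (Eventually.of_forall fun n => hGge _ x)
      linarith
  have hc0 : 0 < c₀ := lt_of_lt_of_le hε hc₀ε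
  have hstep : ∀ k b x, u x * H (k + 1) (cns b x) = H k x := by
    intro k b x
    have e := congrFun (hHL k) x
    have e2 : ‖(1 / 2 : ℝ) • (H (k + 1) (cns false x) + H (k + 1) (cns true x))‖ = c₀ := by
      have := congrArg norm e
      rw [Lop, norm_mul, hu, one_mul, hHc] at this
      exact this
    have e3 := half_eq (hHc _ _).le (hHc _ _).le e2
    have e4 : Pop (H (k + 1)) x = H (k + 1) (cns b x) := by
      unfold Pop
      rw [Complex.real_smul]
      push_cast
      cases b
      · rw [← e3]; ring
      · rw [← e3]; ring
    rw [← e, Lop, e4]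
  let R : ℕ → Seq1 → ℂ := fun k x => H k x * (starRingEnd ℂ) (H (k + 1) x)
  have huu : ∀ x, u x * (starRingEnd ℂ) (u x) = 1 := by
    intro x
    rw [Complex.mul_conj, Complex.normSq_eq_norm_sq, hu]
    simp
  have hRstep : ∀ k b x, R (k + 1) (cns b x) = R k x := by
    intro k b x
    simp only [R]
    rw [← hstep k b x, ← hstep (k + 1) b x, map_mul]
    linear_combination (-(H (k + 1) (cns b x)) *
      (starRingEnd ℂ) (H (k + 1 + 1) (cns b x))) * huu x
  have hRvar : ∀ k N x y, Agree1 N x y → ‖R k x - R k y‖ ≤ 2 * c₀ * (K * θ ^ N) := by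
    intro k N x y hxy
    have e : R k x - R k y = (H k x - H k y) * (starRingEnd ℂ) (H (k + 1) x) +
        H k y * (starRingEnd ℂ) (H (k + 1) x - H (k + 1) y) := by
      simp only [R, map_sub]; ring
    rw [e]
    refine (norm_add_le _ _).trans ?_
    rw [norm_mul, norm_mul, RCLike.norm_conj, RCLike.norm_conj, hHc, hHc]
    have h1 := hHhol k N x y hxy
    have h2 := hHhol (k + 1) N x y hxy
    nlinarith
  have hRvar2 : ∀ n k N x y, Agree1 N x y → ‖R k x - R k y‖ ≤ 2 * c₀ * (K * θ ^ (N + n)) := by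
    intro n
    induction n with
    | zero => intro k N x y hxy; exact hRvar k N x y hxy
    | succ n ih =>
      intro k N x y hxy
      rw [← hRstep k false x, ← hRstep k false y]
      have := ih (k + 1) (N + 1) _ _ (agree_cns hxy false)
      rwa [show N + 1 + n = N + (n + 1) by ring] at this
  have hRconst : ∀ k x y, R k x = R k y := by
    intro k x y
    have l : Tendsto (fun n : ℕ => 2 * c₀ * (K * θ ^ (0 + n))) atTop (𝓝 (2 * c₀ * 0)) := by
      simp only [zero_add]
      exact hθt.const_mul _
    have := ge_of_tendsto' l (fun n => hRvar2 n k 0 x y (fun i hi => by omega))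
    have h0 : ‖R k x - R k y‖ = 0 := le_antisymm (by simpa using this) (norm_nonneg _)
    exact sub_eq_zero.mp (norm_eq_zero.mp h0)
  refine ⟨H 1, c₀, R 0 (fun _ => false) / (c₀ : ℂ) ^ 2, hc0, hHhol 1, hHc 1, ?_⟩
  intro b x
  rw [hstep 0 b x, hRconst 0 _ x]
  have hcc : (c₀ : ℂ) ≠ 0 := by exact_mod_cast hc0.ne'
  have h1 : (starRingEnd ℂ) (H 1 x) * H 1 x = (c₀ : ℂ) ^ 2 := by
    rw [mul_comm, Complex.mul_conj, Complex.normSq_eq_norm_sq, hHc]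
    push_cast; rfl
  simp only [R]
  rw [div_mul_eq_mul_div, eq_div_iff (pow_ne_zero _ hcc), ← h1]
  ring

/-- Exponential decay of the twisted operator. -/
def Dec (θ : ℝ) (u : Seq1 → ℂ) : Prop :=
  ∃ C : ℝ, 0 < C ∧ ∃ r ∈ Set.Ioo (0 : ℝ) 1, ∀ (D : ℝ) (f : Seq1 → ℂ), 0 < D →
    (∀ x, ‖f x‖ ≤ D) → Hol θ D f → ∀ n x, ‖((Lop u)^[n] f) x‖ ≤ C * D * r ^ n

theorem Lop_iter_hol {θ U K ε : ℝ} (hθ : θ ∈ Set.Ioo (0 : ℝ) 1) {u : Seq1 → ℂ}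
    (hu : ∀ x, ‖u x‖ = 1) (hU : Hol θ U u) (hUK : U ≤ K * (1 - θ)) (hε : 0 ≤ ε) {g : Seq1 → ℂ}
    (hg : ∀ x, ‖g x‖ ≤ ε) {A : ℝ} (hgH : Hol θ A g) (m : ℕ) :
    Hol θ (θ ^ m * A + ε * K * (1 - θ ^ m)) ((Lop u)^[m] g) := by
  induction m with
  | zero => simpa using hgH
  | succ m ih =>
    rw [Function.iterate_succ_apply']
    have h := Lop_hol hu hθ.1 hU (Lop_iter_bound hu m hg) ih
    intro N x y hxy
    refine (h N x y hxy).trans ?_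
    have : 0 ≤ θ ^ N := pow_nonneg hθ.1.le _
    apply mul_le_mul_of_nonneg_right _ this
    have := mul_le_mul_of_nonneg_right hUK hε
    have e : θ ^ (m + 1) * A + ε * K * (1 - θ ^ (m + 1)) =
      θ * (θ ^ m * A + ε * K * (1 - θ ^ m)) + K * (1 - θ) * ε := by ring
    rw [e]; linarith

theorem dec_of {θ U : ℝ} (hθ : θ ∈ Set.Ioo (0 : ℝ) 1) {u : Seq1 → ℂ}
    (hu : ∀ x, ‖u x‖ = 1) (hU : Hol θ U u)
    (hno : ¬ ∃ (H : Seq1 → ℂ) (K c : ℝ) (ν : ℂ), 0 < c ∧ Hol θ K H ∧ (∀ x, ‖H x‖ = c) ∧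
      ∀ b x, u x * H (cns b x) = ν * H x) : Dec θ u := by
  obtain ⟨hθ0, hθ1⟩ := hθ
  have h1θ : 0 < 1 - θ := by linarith
  set K : ℝ := max 1 (U / (1 - θ)) with hK
  have hK1 : 1 ≤ K := le_max_left _ _
  have hUK : U ≤ K * (1 - θ) := by
    have : U / (1 - θ) ≤ K := le_max_right _ _
    rwa [div_le_iff₀ h1θ] at this
  have hB : ∀ f : Seq1 → ℂ, (∀ x, ‖f x‖ ≤ 1) → Hol θ K f → Hol θ K (Lop u f) := by
    intro f h1 h2
    have := Lop_iter_hol ⟨hθ0, hθ1⟩ hu hU hUK zero_le_one h1 h2 1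
    simp only [Function.iterate_one] at this
    convert this using 1
    ring
  have hgood : ∃ n, ∀ f : Seq1 → ℂ, (∀ x, ‖f x‖ ≤ 1) → Hol θ K f →
      ∀ x, ‖((Lop u)^[n] f) x‖ ≤ 1 / 4 := by
    by_contra hcon
    push Not at hcon
    apply hno
    obtain ⟨H, c, ν, h⟩ := peripheral (ε := 1 / 4) ⟨hθ0, hθ1⟩ hu hB (by norm_num) (by
      intro n
      obtain ⟨f, h1, h2, x, hx⟩ := hcon n
      exact ⟨f, h1, h2, x, hx.le⟩)
    exact ⟨H, K, c, ν, h⟩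
  have hBn : ∀ n (f : Seq1 → ℂ), (∀ x, ‖f x‖ ≤ 1) → Hol θ K f → Hol θ K ((Lop u)^[n] f) := by
    intro n f h1 h2
    have := Lop_iter_hol ⟨hθ0, hθ1⟩ hu hU hUK zero_le_one h1 h2 n
    convert this using 1
    ring
  obtain ⟨n₀, hn₀⟩ := hgood
  obtain ⟨m, hm⟩ := exists_pow_lt_of_lt_one (show (0 : ℝ) < 1 / 4 by norm_num) hθ1
  set q := m + n₀ + 1 with hq
  have hcontr : ∀ f : Seq1 → ℂ, (∀ x, ‖f x‖ ≤ 1) → Hol θ K f →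
      (∀ x, ‖((Lop u)^[q] f) x‖ ≤ 1 / 2) ∧ Hol θ (K / 2) ((Lop u)^[q] f) := by
    intro f h1 h2
    have h1' : ∀ x, ‖((Lop u)^[1] f) x‖ ≤ 1 := Lop_iter_bound hu 1 h1
    have h2' := hBn 1 f h1 h2
    have h3 := hn₀ _ h1' h2'
    have h4 := hBn n₀ _ h1' h2'
    have h5 := Lop_iter_bound hu m h3
    have h6 := Lop_iter_hol ⟨hθ0, hθ1⟩ hu hU hUK (by norm_num) h3 h4 m
    rw [hq, Function.iterate_add_apply, Function.iterate_add_apply]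
    refine ⟨fun x => (h5 x).trans (by norm_num), ?_⟩
    intro N x y hxy
    refine (h6 N x y hxy).trans ?_
    apply mul_le_mul_of_nonneg_right _ (pow_nonneg hθ0.le _)
    have : 0 ≤ θ ^ m := by positivity
    nlinarith
  have hiter : ∀ k (f : Seq1 → ℂ), (∀ x, ‖f x‖ ≤ 1) → Hol θ K f →
      ∀ x, ‖((Lop u)^[q * k] f) x‖ ≤ (1 / 2) ^ k := by
    intro k
    induction k with
    | zero => intro f h1 _ x; simpa using h1 x
    | succ k ih =>
      intro f h1 h2 x
      obtain ⟨h3, h4⟩ := hcontr f h1 h2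
      have h5 := ih (fun x => 2 * ((Lop u)^[q] f) x) (by
        intro x; rw [norm_mul]; simp only [Complex.norm_ofNat]; linarith [h3 x]) (by
        intro N x y hxy
        rw [← mul_sub, norm_mul]
        simp only [Complex.norm_ofNat]; linarith [h4 N x y hxy]) x
      rw [Lop_iter_smul, norm_mul] at h5
      simp only [Complex.norm_ofNat] at h5
      rw [Nat.mul_succ, Function.iterate_add_apply, pow_succ]
      linarith
  have hq0 : (q : ℝ) ≠ 0 := by
    have : q ≠ 0 := by omega
    exact_mod_cast this
  set r : ℝ := (1 / 2 : ℝ) ^ (1 / (q : ℝ)) with hr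
  have hr0 : 0 < r := by positivity
  have hr1 : r < 1 := by
    apply Real.rpow_lt_one (by norm_num) (by norm_num)
    positivity
  have hrq : r ^ q = 1 / 2 := by
    rw [hr, ← Real.rpow_natCast, ← Real.rpow_mul (by norm_num), one_div_mul_cancel hq0,
      Real.rpow_one]
  refine ⟨2, by norm_num, r, ⟨hr0, hr1⟩, ?_⟩
  intro D f hD h1 h2 n x
  have hDc : (D : ℂ) ≠ 0 := by exact_mod_cast hD.ne'
  have hnD : ‖((D : ℂ)⁻¹)‖ = D⁻¹ := by
    rw [norm_inv, Complex.norm_real, Real.norm_of_nonneg hD.le]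
  have hg1 : ∀ x, ‖(D : ℂ)⁻¹ * f x‖ ≤ 1 := by
    intro x
    rw [norm_mul, hnD, inv_mul_le_iff₀ hD, mul_one]
    exact h1 x
  have hg2 : Hol θ K (fun x => (D : ℂ)⁻¹ * f x) := by
    intro N x y hxy
    rw [← mul_sub, norm_mul, hnD, inv_mul_le_iff₀ hD]
    refine (h2 N x y hxy).trans ?_
    have : 0 ≤ D * θ ^ N := by positivity
    nlinarith
  have e : n = n % q + q * (n / q) := (Nat.mod_add_div n q).symm
  have h3 : ‖((Lop u)^[n] (fun x => (D : ℂ)⁻¹ * f x)) x‖ ≤ (1 / 2) ^ (n / q) := by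
    conv_lhs => rw [e]
    rw [Function.iterate_add_apply]
    exact Lop_iter_bound hu _ (hiter (n / q) _ hg1 hg2) x
  rw [Lop_iter_smul, norm_mul, hnD, inv_mul_le_iff₀ hD] at h3
  refine h3.trans ?_
  have h4 : (1 / 2 : ℝ) ^ (n / q) ≤ 2 * r ^ n := by
    have : r ^ (q * (n / q) + q) ≤ r ^ n := by
      apply pow_le_pow_of_le_one hr0.le hr1.le
      have := Nat.mod_lt n (show 0 < q by omega)
      omega
    rw [pow_add, pow_mul, hrq] at this
    linarith
  nlinarith


/-! ## Phases and block oscillation -/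

/-- Forget the first symbol. -/
def tl (x : Seq1) : Seq1 := fun i => x (i + 1)

theorem tl_cns (b : Bool) (x : Seq1) : tl (cns b x) = x := rfl

theorem tl_iter (n : ℕ) : ∀ (x : Seq1) (i : ℕ), (tl^[n] x) i = x (i + n) := by
  induction n with
  | zero => intro x i; rfl
  | succ n ih => intro x i; rw [Function.iterate_succ_apply, ih]; rfl

theorem agree_tl {n N : ℕ} {x y : Seq1} (h : Agree1 (n + N) x y) :
    Agree1 N (tl^[n] x) (tl^[n] y) := by
  intro i hi
  rw [tl_iter, tl_iter]
  exact h _ (by omega)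

/-- Product of `u` along the tails. -/
noncomputable def ph (u : Seq1 → ℂ) : ℕ → Seq1 → ℂ
  | 0, _ => 1
  | (n + 1), y => u (tl y) * ph u n (tl y)

theorem ph_norm {u : Seq1 → ℂ} (hu : ∀ x, ‖u x‖ = 1) (n : ℕ) : ∀ y, ‖ph u n y‖ = 1 := by
  induction n with
  | zero => intro y; simp [ph]
  | succ n ih => intro y; simp [ph, hu, ih]

theorem ph_add (u : Seq1 → ℂ) (a b : ℕ) : ∀ y,
    ph u (a + b) y = ph u a (tl^[b] y) * ph u b y := by
  induction b with
  | zero => intro y; simp [ph]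
  | succ b ih =>
    intro y
    rw [← add_assoc]
    simp only [ph, Function.iterate_succ_apply, ih]
    ring

theorem ph_one (n : ℕ) : ∀ y, ph (fun _ => 1) n y = 1 := by
  induction n with
  | zero => intro y; rfl
  | succ n ih => intro y; simp [ph, ih]

theorem ph_sq (u : Seq1 → ℂ) (n : ℕ) : ∀ y, ph (fun x => u x ^ 2) n y = ph u n y ^ 2 := by
  induction n with
  | zero => intro y; simp [ph]
  | succ n ih => intro y; simp [ph, ih, mul_pow]

theorem ph_var {θ U : ℝ} (hθ : θ ∈ Set.Ioo (0 : ℝ) 1) (hU0 : 0 ≤ U) {u : Seq1 → ℂ}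
    (hu : ∀ x, ‖u x‖ = 1) (hU : Hol θ U u) (k : ℕ) : ∀ N x y, Agree1 (k + N) x y →
    ‖ph u k x - ph u k y‖ ≤ k * U * θ ^ N := by
  induction k with
  | zero => intro N x y _; simp [ph]
  | succ k ih =>
    intro N x y hxy
    have ht : Agree1 (k + N) (tl x) (tl y) := fun i hi => hxy (i + 1) (by omega)
    have h1 := ih N _ _ ht
    have h2 := hU _ _ _ ht
    have e : ph u (k + 1) x - ph u (k + 1) y = u (tl x) * (ph u k (tl x) - ph u k (tl y)) +
        (u (tl x) - u (tl y)) * ph u k (tl y) := by simp only [ph]; ring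
    rw [e]
    refine (norm_add_le _ _).trans ?_
    rw [norm_mul, norm_mul, hu, ph_norm hu, one_mul, mul_one]
    have h3 : U * θ ^ (k + N) ≤ U * θ ^ N := by
      apply mul_le_mul_of_nonneg_left _ hU0
      exact pow_le_pow_of_le_one hθ.1.le hθ.2.le (by omega)
    push_cast
    linarith

theorem Pop_ph (u : Seq1 → ℂ) (N h : ℕ) : ∀ s : Seq1 → ℂ,
    Pop^[h] (fun y => ph u (h + N) y * s y) = fun x => ph u N x * ((Lop u)^[h] s) x := by
  induction h with
  | zero => intro s; simp
  | succ h ih =>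
    intro s
    rw [Function.iterate_succ_apply, Function.iterate_succ_apply, ← ih]
    congr 1
    funext x
    rw [show h + 1 + N = h + N + 1 by ring]
    simp only [Pop, Lop, ph, tl_cns, Complex.real_smul]
    ring

theorem Pop_tl (g : Seq1 → ℂ) (p : ℕ) : ∀ S : Seq1 → ℂ,
    Pop^[p] (fun y => g (tl^[p] y) * S y) = fun x => g x * (Pop^[p] S) x := by
  induction p with
  | zero => intro s; simp
  | succ p ih =>
    intro S
    rw [Function.iterate_succ_apply, Function.iterate_succ_apply, ← ih]
    congr 1
    funext x
    simp only [Pop, Function.iterate_succ_apply, tl_cns, Complex.real_smul]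
    ring

theorem Pop_lin (c d : ℂ) (n : ℕ) : ∀ F G : Seq1 → ℂ,
    Pop^[n] (fun y => c * F y + d * G y) = fun x => c * (Pop^[n] F) x + d * (Pop^[n] G) x := by
  induction n with
  | zero => intro F G; rfl
  | succ n ih =>
    intro F G
    simp only [Function.iterate_succ_apply]
    rw [← ih]
    congr 1
    funext x
    simp only [Pop, Complex.real_smul]
    ring

theorem Pop_re (n : ℕ) : ∀ F : Seq1 → ℂ,
    Pop^[n] (fun y => (F y).re) = fun x => ((Pop^[n] F) x).re := by
  induction n with
  | zero => intro F; rfl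
  | succ n ih =>
    intro F
    simp only [Function.iterate_succ_apply]
    rw [← ih]
    congr 1
    funext x
    simp only [Pop, Complex.smul_re, Complex.add_re]

/-- Oscillation decay. -/
def Good (θ : ℝ) (u : Seq1 → ℂ) : Prop :=
  ∃ C : ℝ, 0 < C ∧ ∃ r ∈ Set.Ioo (0 : ℝ) 1, ∀ (D : ℝ) (f : Seq1 → ℂ), 0 < D →
    (∀ x, ‖f x‖ ≤ D) → Hol θ D f → ∀ n N x y,
      ‖ph u N x * ((Lop u)^[n] f) x - ph u N y * ((Lop u)^[n] f) y‖ ≤ C * D * r ^ n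

theorem good_one {θ : ℝ} (hθ : θ ∈ Set.Ioo (0 : ℝ) 1) : Good θ (fun _ => 1) := by
  refine ⟨1, one_pos, θ, hθ, ?_⟩
  intro D f hD h1 h2 n N x y
  rw [ph_one, ph_one]
  have := Lop_iter_hol (u := fun _ => 1) (U := 0) (K := 0) (ε := D) hθ (by simp)
    (by intro N x y _; simp) (by simp) hD.le h1 h2 n 0 x y (fun i hi => by omega)
  simp only [one_mul]
  linarith

theorem good_of_dec {θ : ℝ} {u : Seq1 → ℂ} (hu : ∀ x, ‖u x‖ = 1) (h : Dec θ u) :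
    Good θ u := by
  obtain ⟨C, hC, r, hr, h⟩ := h
  refine ⟨2 * C, by positivity, r, hr, ?_⟩
  intro D f hD h1 h2 n N x y
  have hx := h D f hD h1 h2 n x
  have hy := h D f hD h1 h2 n y
  refine (norm_sub_le _ _).trans ?_
  rw [norm_mul, norm_mul, ph_norm hu, ph_norm hu]
  linarith

theorem good_of {θ U : ℝ} (hθ : θ ∈ Set.Ioo (0 : ℝ) 1) {u : Seq1 → ℂ}
    (hu : ∀ x, ‖u x‖ = 1) (hU : Hol θ U u)
    (hwm : ∀ (H : Seq1 → ℂ) (K c : ℝ) (ν : ℂ), 0 < c → Hol θ K H → (∀ x, ‖H x‖ = c) →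
      (∀ b x, u x * H (cns b x) = ν * H x) → ν = 1 ∧ ∀ x y, H x = H y) : Good θ u := by
  by_cases hno : ∃ (H : Seq1 → ℂ) (K c : ℝ) (ν : ℂ), 0 < c ∧ Hol θ K H ∧ (∀ x, ‖H x‖ = c) ∧
      ∀ b x, u x * H (cns b x) = ν * H x
  · obtain ⟨H, K, c, ν, hc, h1, h2, h3⟩ := hno
    obtain ⟨h4, h5⟩ := hwm H K c ν hc h1 h2 h3
    have : u = fun _ => 1 := by
      funext x
      have e := h3 false x
      rw [h4, h5 (cns false x) x] at e
      have hne : H x ≠ 0 := by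
        intro h0
        have := h2 x
        rw [h0, norm_zero] at this
        linarith
      exact mul_right_cancel₀ hne e
    rw [this]
    exact good_one hθ
  · exact good_of_dec hu (dec_of hθ hu hU hno)

/-- Block function. -/
noncomputable def Sblk (u W : Seq1 → ℂ) (p : ℕ) (y : Seq1) : ℂ :=
  ∑ k ∈ Finset.Icc 1 p, ph u k (tl^[p - k] y) * W (tl^[p - k] y)

theorem Sblk_bound {u W : Seq1 → ℂ} {D : ℝ} (hu : ∀ x, ‖u x‖ = 1) (hD : 1 ≤ D)
    (hW : ∀ x, ‖W x‖ ≤ D) (p : ℕ) (y : Seq1) : ‖Sblk u W p y‖ ≤ (p + 1) ^ 2 * D ^ 2 := by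
  have h : ‖Sblk u W p y‖ ≤ ∑ k ∈ Finset.Icc 1 p, D := by
    refine norm_sum_le_of_le _ ?_
    intro k _
    rw [norm_mul, ph_norm hu, one_mul]
    exact hW _
  rw [Finset.sum_const, Nat.card_Icc, nsmul_eq_mul] at h
  simp only [add_tsub_cancel_right] at h
  have hp : (0 : ℝ) ≤ p := Nat.cast_nonneg p
  have h2 : D ≤ D ^ 2 := by nlinarith
  have h3 : (p : ℝ) ≤ (p + 1) ^ 2 := by nlinarith
  exact h.trans (mul_le_mul h3 h2 (by linarith) (by positivity))

theorem Sblk_var {θ : ℝ} (hθ : θ ∈ Set.Ioo (0 : ℝ) 1) {u W : Seq1 → ℂ} {D : ℝ}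
    (hu : ∀ x, ‖u x‖ = 1) (hD : 1 ≤ D) (hU : Hol θ D u)
    (hW : ∀ x, ‖W x‖ ≤ D) (hWH : Hol θ D W) (p N : ℕ) (x y : Seq1)
    (hxy : Agree1 (p + N) x y) :
    ‖Sblk u W p x - Sblk u W p y‖ ≤ (p + 1) ^ 2 * D ^ 2 * θ ^ N := by
  have h : ‖Sblk u W p x - Sblk u W p y‖ ≤
      ∑ k ∈ Finset.Icc 1 p, ((p + 1) * D ^ 2 * θ ^ N) := by
    unfold Sblk
    rw [← Finset.sum_sub_distrib]
    refine norm_sum_le_of_le _ ?_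
    intro k hk
    rw [Finset.mem_Icc] at hk
    have ha : Agree1 (k + N) (tl^[p - k] x) (tl^[p - k] y) := by
      apply agree_tl
      rwa [show p - k + (k + N) = p + N by omega]
    set X := tl^[p - k] x
    set Y := tl^[p - k] y
    have h1 := ph_var hθ (by linarith) hu hU k N X Y ha
    have h2 := hWH N X Y (agree_mono ha (by omega))
    have h3 := hW Y
    have e : ph u k X * W X - ph u k Y * W Y =
      ph u k X * (W X - W Y) + (ph u k X - ph u k Y) * W Y := by ring
    rw [e]
    refine (norm_add_le _ _).trans ?_
    rw [norm_mul, norm_mul, ph_norm hu, one_mul]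
    have hkp : (k : ℝ) ≤ p := by exact_mod_cast hk.2
    have hN : 0 ≤ θ ^ N := pow_nonneg hθ.1.le _
    calc _ ≤ D * θ ^ N + (k * D * θ ^ N) * D := by gcongr
      _ ≤ D ^ 2 * θ ^ N + (p * D * θ ^ N) * D := by
          gcongr
          nlinarith
      _ = _ := by ring
  rw [Finset.sum_const, Nat.card_Icc, nsmul_eq_mul] at h
  simp only [add_tsub_cancel_right] at h
  have hp : (0 : ℝ) ≤ p := Nat.cast_nonneg p
  have hN : 0 ≤ θ ^ N := pow_nonneg hθ.1.le _
  refine h.trans ?_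
  have : 0 ≤ (p + 1) * D ^ 2 * θ ^ N := by positivity
  nlinarith

/-- Block observable as a function of the past at the end of the block. -/
noncomputable def Xi (a : ℂ) (u W : Seq1 → ℂ) (M p : ℕ) (y : Seq1) : ℝ :=
  (a * (ph u M (tl^[p] y) * Sblk u W p y)).re

theorem mul_var {A t : ℝ} {a b a' b' : ℂ} (ha : ‖a‖ ≤ A) (hb' : ‖b'‖ ≤ A)
    (h1 : ‖a - a'‖ ≤ A * t) (h2 : ‖b - b'‖ ≤ A * t) :
    ‖a * b - a' * b'‖ ≤ 2 * A ^ 2 * t := by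
  have e : a * b - a' * b' = a * (b - b') + (a - a') * b' := by ring
  rw [e]
  refine (norm_add_le _ _).trans ?_
  rw [norm_mul, norm_mul]
  have hA : 0 ≤ A := (norm_nonneg _).trans ha
  have h3 : ‖a‖ * ‖b - b'‖ ≤ A * (A * t) := mul_le_mul ha h2 (norm_nonneg _) hA
  have h4 : ‖a - a'‖ * ‖b'‖ ≤ (A * t) * A :=
    mul_le_mul h1 hb' (norm_nonneg _) ((norm_nonneg _).trans h1)
  linarith

theorem osc_piece (u : Seq1 → ℂ) (p h N : ℕ) (S : Seq1 → ℂ) :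
    Pop^[h + p] (fun y => ph u (h + N) (tl^[p] y) * S y) =
      fun x => ph u N x * ((Lop u)^[h] (Pop^[p] S)) x := by
  rw [Function.iterate_add_apply, Pop_tl, Pop_ph]

theorem osc_main {θ : ℝ} (hθ : θ ∈ Set.Ioo (0 : ℝ) 1) {u W : Seq1 → ℂ} {D : ℝ}
    (hu : ∀ x, ‖u x‖ = 1) (hD : 1 ≤ D) (hU : Hol θ D u)
    (hW : ∀ x, ‖W x‖ ≤ D) (hWH : Hol θ D W) (a : ℂ) (ha : ‖a‖ = 1)
    (g1 : Good θ u) (g2 : Good θ (fun x => u x ^ 2)) :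
    ∃ C : ℝ, 0 < C ∧ ∃ r ∈ Set.Ioo (0 : ℝ) 1, ∀ (p h N : ℕ) (x y : Seq1),
      |(Pop^[h + p] (Xi a u W (h + N) p)) x - (Pop^[h + p] (Xi a u W (h + N) p)) y| ≤
        C * (p + 1) ^ 4 * r ^ h ∧
      |(Pop^[h + p] (fun z => Xi a u W (h + N) p z ^ 2)) x -
        (Pop^[h + p] (fun z => Xi a u W (h + N) p z ^ 2)) y| ≤
        C * (p + 1) ^ 4 * r ^ h := by
  obtain ⟨C1, hC1, r1, ⟨hr1, hr1'⟩, g1⟩ := g1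
  obtain ⟨C2, hC2, r2, ⟨hr2, hr2'⟩, g2⟩ := g2
  obtain ⟨C0, hC0, r0, ⟨hr0, hr0'⟩, g0⟩ := good_one hθ
  have hD0 : 0 < D := by linarith
  refine ⟨(C0 + C1 + C2) * (2 * D ^ 4), by positivity, max r0 (max r1 r2),
    ⟨by simp [hr0], by simp [*]⟩, ?_⟩
  intro p h N x y
  set r := max r0 (max r1 r2) with hr
  have hpow0 : r0 ^ h ≤ r ^ h := pow_le_pow_left₀ hr0.le (le_max_left _ _) _
  have hpow1 : r1 ^ h ≤ r ^ h :=
    pow_le_pow_left₀ hr1.le ((le_max_left _ _).trans (le_max_right _ _)) _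
  have hpow2 : r2 ^ h ≤ r ^ h :=
    pow_le_pow_left₀ hr2.le ((le_max_right _ _).trans (le_max_right _ _)) _
  have hrh : 0 ≤ r ^ h := (pow_nonneg hr0.le _).trans hpow0
  set A : ℝ := (p + 1) ^ 2 * D ^ 2 with hA
  have hp : (0 : ℝ) ≤ p := Nat.cast_nonneg p
  have hA1 : 1 ≤ A := by
    have h1 : (1 : ℝ) ≤ (p + 1) ^ 2 := by nlinarith
    have h2 : 1 ≤ D ^ 2 := by nlinarith
    nlinarith
  have hA2 : A ≤ 2 * A ^ 2 := by nlinarith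
  have hAA : A ^ 2 ≤ 2 * A ^ 2 := by nlinarith
  have hApos : 0 < 2 * A ^ 2 := by positivity
  have hAe : 2 * A ^ 2 = 2 * D ^ 4 * (p + 1) ^ 4 := by rw [hA]; ring
  have hSb := Sblk_bound hu hD hW p
  have hSv := fun N x y => Sblk_var hθ hu hD hU hW hWH p N x y
  set S := Sblk u W p with hS
  have hθN : ∀ N : ℕ, 0 ≤ θ ^ N := fun N => pow_nonneg hθ.1.le N
  -- s1
  have b1 : ∀ x, ‖(Pop^[p] S) x‖ ≤ 2 * A ^ 2 :=
    Pop_iter_bound p (fun x => (hSb x).trans hA2)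
  have v1 : Hol θ (2 * A ^ 2) (Pop^[p] S) := by
    apply Pop_iter_sub_bound
    intro N x y hxy
    exact (hSv N x y hxy).trans (mul_le_mul_of_nonneg_right hA2 (hθN N))
  have b2 : ∀ x, ‖(Pop^[p] (fun y => S y * S y)) x‖ ≤ 2 * A ^ 2 :=
    Pop_iter_bound p (fun x => by
      rw [norm_mul]; nlinarith [hSb x, norm_nonneg (S x)])
  have v2 : Hol θ (2 * A ^ 2) (Pop^[p] (fun y => S y * S y)) := by
    apply Pop_iter_sub_bound
    intro N x y hxy
    exact mul_var (hSb x) (hSb y) (hSv N x y hxy) (hSv N x y hxy)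
  have b0 : ∀ x, ‖(Pop^[p] (fun y => S y * (starRingEnd ℂ) (S y))) x‖ ≤ 2 * A ^ 2 :=
    Pop_iter_bound p (fun x => by
      rw [norm_mul, RCLike.norm_conj]; nlinarith [hSb x, norm_nonneg (S x)])
  have v0 : Hol θ (2 * A ^ 2) (Pop^[p] (fun y => S y * (starRingEnd ℂ) (S y))) := by
    apply Pop_iter_sub_bound
    intro N x y hxy
    apply mul_var (hSb x) _ (hSv N x y hxy)
    · rw [← map_sub, RCLike.norm_conj]
      exact hSv N x y hxy
    · rw [RCLike.norm_conj]; exact hSb y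
  have o1 := g1 _ _ hApos b1 v1 h N x y
  have o2 := g2 _ _ hApos b2 v2 h N x y
  have o0 := g0 _ _ hApos b0 v0 h N x y
  constructor
  · have e : Pop^[h + p] (Xi a u W (h + N) p) =
        fun x => (a * (ph u N x * ((Lop u)^[h] (Pop^[p] S)) x)).re := by
      have e1 : Xi a u W (h + N) p = fun y =>
          ((fun y => a * (fun y => ph u (h + N) (tl^[p] y) * S y) y +
            0 * (fun _ => (0 : ℂ)) y) y).re := by
        funext y; simp [Xi, hS]
      rw [e1, Pop_re, Pop_lin, osc_piece]
      simp
    rw [e]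
    simp only
    rw [← Complex.sub_re, ← mul_sub]
    refine (Complex.abs_re_le_norm _).trans ?_
    rw [norm_mul, ha, one_mul]
    refine o1.trans ?_
    rw [hAe]
    calc C1 * (2 * D ^ 4 * (p + 1) ^ 4) * r1 ^ h ≤ C1 * (2 * D ^ 4 * (p + 1) ^ 4) * r ^ h := by
          gcongr
      _ ≤ (C0 + C1 + C2) * (2 * D ^ 4 * (p + 1) ^ 4) * r ^ h := by
          gcongr; linarith
      _ = _ := by ring
  · have e : Pop^[h + p] (fun z => Xi a u W (h + N) p z ^ 2) =
        fun x => ((a ^ 2 / 2) * (ph (fun x => u x ^ 2) N x *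
            ((Lop (fun x => u x ^ 2))^[h] (Pop^[p] (fun y => S y * S y))) x) +
          (1 / 2) * (ph (fun _ => 1) N x *
            ((Lop (fun _ => 1))^[h] (Pop^[p] (fun y => S y * (starRingEnd ℂ) (S y)))) x)).re := by
      suffices e0 : (fun z => Xi a u W (h + N) p z ^ 2) = fun y =>
          ((fun y => (a ^ 2 / 2) *
              (fun y => ph (fun x => u x ^ 2) (h + N) (tl^[p] y) * (fun y => S y * S y) y) y +
            (1 / 2) * (fun y => ph (fun _ => 1) (h + N) (tl^[p] y) *
              (fun y => S y * (starRingEnd ℂ) (S y)) y) y) y).re by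
        rw [e0, Pop_re, Pop_lin, osc_piece, osc_piece]
      funext y
      simp only
      have n1 : ‖a * ph u (h + N) (tl^[p] y)‖ = 1 := by
        rw [norm_mul, ha, ph_norm hu, one_mul]
      have n2 : S y * (starRingEnd ℂ) (S y) = (a * (ph u (h + N) (tl^[p] y) * S y)) *
          (starRingEnd ℂ) (a * (ph u (h + N) (tl^[p] y) * S y)) := by
        have n3 : (a * ph u (h + N) (tl^[p] y)) *
            (starRingEnd ℂ) (a * ph u (h + N) (tl^[p] y)) = 1 := by
          rw [Complex.mul_conj, Complex.normSq_eq_norm_sq, n1]; simp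
        rw [← mul_assoc a, map_mul (starRingEnd ℂ) (a * _)]
        linear_combination (-(S y * (starRingEnd ℂ) (S y))) * n3
      rw [ph_sq, ph_one, n2]
      unfold Xi
      set z := a * (ph u (h + N) (tl^[p] y) * Sblk u W p y) with hz
      have : a ^ 2 / 2 * (ph u (h + N) (tl^[p] y) ^ 2 * (S y * S y)) +
          1 / 2 * (1 * (z * (starRingEnd ℂ) z)) =
          (1 / 2 : ℂ) * (z * z + z * (starRingEnd ℂ) z) := by
        rw [hz]; ring
      rw [this, ← mul_add, Complex.add_conj]
      have e5 : (1 / 2 : ℂ) * (z * ((2 * z.re : ℝ) : ℂ)) = ((z.re : ℝ) : ℂ) * z := by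
        push_cast; ring
      rw [e5, Complex.re_ofReal_mul]
      ring
    rw [e]
    simp only
    rw [← Complex.sub_re, add_sub_add_comm, ← mul_sub, ← mul_sub]
    refine (Complex.abs_re_le_norm _).trans ?_
    refine (norm_add_le _ _).trans ?_
    rw [norm_mul, norm_mul, norm_div, norm_pow, ha]
    norm_num only [Complex.norm_ofNat, norm_div, norm_one]
    rw [hAe] at o2 o0
    have q2 : C2 * (2 * D ^ 4 * (p + 1) ^ 4) * r2 ^ h ≤
        (C0 + C1 + C2) * (2 * D ^ 4 * (p + 1) ^ 4) * r ^ h := by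
      gcongr; linarith
    have q0 : C0 * (2 * D ^ 4 * (p + 1) ^ 4) * r0 ^ h ≤
        (C0 + C1 + C2) * (2 * D ^ 4 * (p + 1) ^ 4) * r ^ h := by
      gcongr; linarith
    have e6 : (C0 + C1 + C2) * (2 * D ^ 4) * (↑p + 1) ^ 4 * r ^ h =
        (C0 + C1 + C2) * (2 * D ^ 4 * (p + 1) ^ 4) * r ^ h := by ring
    rw [e6]
    linarith


/-! ## Conditional expectations -/

/-- The past of `ω` seen from time `M`. -/
def pst (M : ℤ) (ω : Seq2) : Seq1 := fun i => ω (M - i)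

theorem pst_succ (M : ℤ) (ω : Seq2) : pst (M + 1) ω = cns (ω (M + 1)) (pst M ω) := by
  funext i
  cases i with
  | zero => simp [pst, cns]
  | succ i => simp only [pst, cns]; congr 1; push_cast; ring

/-- Flip the coordinate `M`. -/
def flp (M : ℤ) (ω : Seq2) : Seq2 := fun i => if i = M then !(ω i) else ω i

theorem flp_flp (M : ℤ) (ω : Seq2) : flp M (flp M ω) = ω := by
  funext i
  by_cases h : i = M <;> simp [flp, h]

theorem flp_meas (M : ℤ) : Measurable (flp M) := by
  rw [measurable_pi_iff]
  intro i
  unfold flp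
  by_cases h : i = M
  · simp only [h, if_true]
    exact (measurable_of_finite (fun b : Bool => !b)).comp (measurable_pi_apply M)
  · simp only [h, if_false]
    exact measurable_pi_apply i

theorem pst_flp (M : ℤ) (ω : Seq2) : pst M (flp (M + 1) ω) = pst M ω := by
  funext i
  have : M - (i : ℤ) ≠ M + 1 := by omega
  simp [pst, flp, this]

theorem pst_cont (M : ℤ) : Continuous (pst M) := by
  unfold pst
  fun_prop

theorem bern_ext {μ ν : Measure Seq2} (hμ : IsBernoulli2 μ)
    (hν : IsBernoulli2 ν) : μ = ν := by
  have := hμ.1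
  have := hν.1
  let 𝒞 : Set (Set Seq2) := {A | A = ∅ ∨ ∃ (s : Finset ℤ) (x : ℤ → Bool),
    A = {ω : Seq2 | ∀ i ∈ s, ω i = x i}}
  refine ext_of_generate_finite 𝒞 ?_ ?_ ?_ (by simp)
  · apply le_antisymm
    · rw [MeasurableSpace.pi_eq_generateFrom_projections]
      apply MeasurableSpace.generateFrom_le
      rintro A ⟨i, t, ht, rfl⟩
      have h1 : ∀ b : Bool, MeasurableSet[MeasurableSpace.generateFrom 𝒞] {ω : Seq2 | ω i = b} := by
        intro b
        apply MeasurableSpace.measurableSet_generateFrom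
        right
        exact ⟨{i}, fun _ => b, by simp⟩
      have : Function.eval i ⁻¹' t = ⋃ b ∈ t, {ω : Seq2 | ω i = b} := by
        ext ω; simp
      rw [this]
      exact MeasurableSet.biUnion (Set.to_countable _) (fun b _ => h1 b)
    · apply MeasurableSpace.generateFrom_le
      rintro A (rfl | ⟨s, x, rfl⟩)
      · exact MeasurableSet.empty
      · have : {ω : Seq2 | ∀ i ∈ s, ω i = x i} = ⋂ i ∈ s, (fun ω : Seq2 => ω i) ⁻¹' {x i} := by
          ext ω; simp
        rw [this]
        exact Finset.measurableSet_biInter _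
          (fun i _ => (measurable_pi_apply i) (MeasurableSet.singleton _))
  · rintro A (rfl | ⟨s, x, rfl⟩) B (rfl | ⟨t, y, rfl⟩) hne
    · left; simp
    · left; simp
    · left; simp
    · obtain ⟨ω, h1, h2⟩ := hne
      right
      refine ⟨s ∪ t, ω, ?_⟩
      ext η
      simp only [Set.mem_inter_iff, Set.mem_ofPred_eq, Finset.mem_union] at *
      constructor
      · rintro ⟨h3, h4⟩ i (hi | hi)
        · rw [h3 i hi, h1 i hi]
        · rw [h4 i hi, h2 i hi]
      · intro h3
        exact ⟨fun i hi => by rw [h3 i (Or.inl hi), h1 i hi],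
          fun i hi => by rw [h3 i (Or.inr hi), h2 i hi]⟩
  · rintro A (rfl | ⟨s, x, rfl⟩)
    · simp
    · rw [hμ.2, hν.2]

theorem bern_flp {μ : Measure Seq2} (hμ : IsBernoulli2 μ) (M : ℤ) :
    MeasurePreserving (flp M) μ μ := by
  have := hμ.1
  refine ⟨flp_meas M, ?_⟩
  apply bern_ext _ hμ
  refine ⟨Measure.isProbabilityMeasure_map (flp_meas M).aemeasurable, ?_⟩
  intro s x
  have hm : MeasurableSet {ω : Seq2 | ∀ i ∈ s, ω i = x i} := by
    have : {ω : Seq2 | ∀ i ∈ s, ω i = x i} = ⋂ i ∈ s, (fun ω : Seq2 => ω i) ⁻¹' {x i} := by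
      ext ω; simp
    rw [this]
    exact Finset.measurableSet_biInter _
      (fun i _ => (measurable_pi_apply i) (MeasurableSet.singleton _))
  rw [Measure.map_apply (flp_meas M) hm, ← hμ.2 s (flp M x)]
  congr 1
  ext ω
  simp only [Set.mem_preimage, Set.mem_ofPred_eq]
  apply forall₂_congr
  intro i _
  by_cases h : i = M
  · simp only [flp, h, if_true]
    cases ω M <;> cases x M <;> simp
  · simp [flp, h]

theorem Falg_le (M : ℤ) : Falg M ≤ (inferInstance : MeasurableSpace Seq2) := by
  unfold Falg
  rw [← measurable_iff_comap_le]
  rw [measurable_pi_iff]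
  intro l
  exact measurable_pi_apply _

theorem Falg_mono {M N : ℤ} (h : M ≤ N) : Falg M ≤ Falg N := by
  unfold Falg
  rw [← measurable_iff_comap_le]
  refine @measurable_pi_lambda _ _ _ (_) _ _ ?_
  intro l
  have hm : Measurable (fun g : {l : ℤ // l ≤ N} → Bool => g ⟨l.1, l.2.trans h⟩) :=
    measurable_pi_apply _
  exact hm.comp (comap_measurable _)

theorem pst_meas (M : ℤ) : Measurable[Falg M] (pst M) := by
  refine @measurable_pi_lambda _ _ _ (_) _ _ ?_
  intro i
  have hm : Measurable (fun g : {l : ℤ // l ≤ M} → Bool => g ⟨M - i, by omega⟩) :=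
    measurable_pi_apply _
  exact hm.comp (comap_measurable _)

theorem Falg_flp {M : ℤ} {s : Set Seq2} (hs : MeasurableSet[Falg M] s) :
    flp (M + 1) ⁻¹' s = s := by
  obtain ⟨t, _, rfl⟩ := hs
  ext ω
  simp only [Set.mem_preimage]
  have : (fun l : {l : ℤ // l ≤ M} => flp (M + 1) ω l.1) = fun l => ω l.1 := by
    funext l
    have : (l : ℤ) ≠ M + 1 := by have := l.2; omega
    simp [flp, this]
  rw [this]

theorem cont_int {μ : Measure Seq2} [IsProbabilityMeasure μ] {F : Seq2 → ℝ} (hF : Continuous F) :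
    Integrable F μ := by
  obtain ⟨C, hC⟩ := isCompact_univ.exists_bound_of_continuousOn hF.continuousOn
  exact Integrable.of_bound hF.measurable.aestronglyMeasurable C
    (Eventually.of_forall fun x => hC x trivial)

theorem cns_cont (b : Bool) : Continuous (cns b) := by
  apply continuous_pi
  intro i
  cases i with
  | zero => exact continuous_const
  | succ i => exact continuous_apply i

theorem Pop_cont {G : Seq1 → ℝ} (hG : Continuous G) : Continuous (Pop G) := by
  unfold Pop
  have h1 := hG.comp (cns_cont false)
  have h2 := hG.comp (cns_cont true)
  exact (h1.add h2).const_smul (1 / 2 : ℝ)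

theorem ce_step {μ : Measure Seq2} (hμ : IsBernoulli2 μ) {G : Seq1 → ℝ} (hG : Continuous G)
    (M : ℤ) : μ[fun ω => G (pst (M + 1) ω) | Falg M] =ᵐ[μ] fun ω => Pop G (pst M ω) := by
  have := hμ.1
  have hi : Integrable (fun ω => G (pst (M + 1) ω)) μ := cont_int (hG.comp (pst_cont _))
  have hi2 : Integrable (fun ω => Pop G (pst M ω)) μ :=
    cont_int ((Pop_cont hG).comp (pst_cont _))
  symm
  refine ae_eq_condExp_of_forall_setIntegral_eq (Falg_le M) hi (fun s _ _ => hi2.integrableOn) ?_ ?_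
  · intro s hs _
    have hs' := Falg_le M s hs
    have e : ∀ ω, Pop G (pst M ω) =
        (1 / 2) * (G (pst (M + 1) ω) + G (pst (M + 1) (flp (M + 1) ω))) := by
      intro ω
      rw [pst_succ, pst_succ, pst_flp]
      have : flp (M + 1) ω (M + 1) = !(ω (M + 1)) := by simp [flp]
      rw [this, Pop, smul_eq_mul]
      cases ω (M + 1)
      · rfl
      · rw [add_comm]; rfl
    have hmp := bern_flp hμ (M + 1)
    have hi3 : Integrable (fun ω => G (pst (M + 1) (flp (M + 1) ω))) μ :=
      hmp.integrable_comp_of_integrable hi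
    have e2 : ∫ ω in s, G (pst (M + 1) (flp (M + 1) ω)) ∂μ = ∫ ω in s, G (pst (M + 1) ω) ∂μ := by
      have emb : MeasurableEmbedding (flp (M + 1)) :=
        (MeasurableEquiv.mk ⟨flp (M + 1), flp (M + 1), flp_flp _, flp_flp _⟩
          (flp_meas _) (flp_meas _)).measurableEmbedding
      have := hmp.setIntegral_preimage_emb emb (fun ω => G (pst (M + 1) ω)) s
      rwa [Falg_flp hs] at this
    simp_rw [e]
    rw [integral_const_mul, integral_add hi.integrableOn hi3.integrableOn, e2]
    ring
  · exact (((Pop_cont hG).measurable.comp (pst_meas M)).stronglyMeasurable).aestronglyMeasurable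

theorem ce_iter {μ : Measure Seq2} (hμ : IsBernoulli2 μ) (M : ℤ) (k : ℕ) :
    ∀ {G : Seq1 → ℝ} (_ : Continuous G),
    μ[fun ω => G (pst (M + k) ω) | Falg M] =ᵐ[μ] fun ω => (Pop^[k] G) (pst M ω) := by
  have := hμ.1
  induction k with
  | zero =>
    intro G hG
    have : StronglyMeasurable[Falg M] (fun ω => G (pst M ω)) :=
      (hG.measurable.comp (pst_meas M)).stronglyMeasurable
    simp only [Nat.cast_zero, add_zero, Function.iterate_zero, id]
    rw [condExp_of_stronglyMeasurable (Falg_le M) this (cont_int (hG.comp (pst_cont _)))]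
  | succ k ih =>
    intro G hG
    rw [Function.iterate_succ_apply]
    have h1 := ih (Pop_cont hG)
    have h2 := ce_step hμ hG (M + k)
    have h3 := condExp_condExp_of_le (μ := μ) (f := fun ω => G (pst (M + k + 1) ω))
      (Falg_mono (show M ≤ M + k by omega)) (Falg_le _)
    have h4 := condExp_congr_ae (m := Falg M) h2
    have e : M + ((k + 1 : ℕ) : ℤ) = M + k + 1 := by push_cast; ring
    rw [e]
    exact h3.symm.trans (h4.trans h1)

theorem ce_bound {μ : Measure Seq2} (hμ : IsBernoulli2 μ) (M : ℤ) (k : ℕ)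
    {G : Seq1 → ℝ} (hG : Continuous G) {δ : ℝ}
    (hosc : ∀ x y, |(Pop^[k] G) x - (Pop^[k] G) y| ≤ δ) :
    ∀ᵐ ω ∂μ, |(μ[fun ω => G (pst (M + k) ω) | Falg M]) ω - ∫ ω, G (pst (M + k) ω) ∂μ| ≤ δ := by
  have := hμ.1
  have h := ce_iter hμ M k hG
  have hc : Continuous (Pop^[k] G) := by
    clear h hosc
    induction k generalizing G with
    | zero => exact hG
    | succ k ih => rw [Function.iterate_succ_apply]; exact ih (Pop_cont hG)
  have hi : Integrable (fun ω => (Pop^[k] G) (pst M ω)) μ := cont_int (hc.comp (pst_cont _))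
  have e : ∫ ω, G (pst (M + k) ω) ∂μ = ∫ ω, (Pop^[k] G) (pst M ω) ∂μ := by
    rw [← integral_condExp (Falg_le M), integral_congr_ae h]
  filter_upwards [h] with ω hω
  rw [hω, e]
  have : (Pop^[k] G) (pst M ω) - ∫ ω', (Pop^[k] G) (pst M ω') ∂μ =
      ∫ ω', ((Pop^[k] G) (pst M ω) - (Pop^[k] G) (pst M ω')) ∂μ := by
    rw [integral_sub (integrable_const _) hi]; simp
  rw [this, ← Real.norm_eq_abs]
  have := norm_integral_le_of_norm_le_const (μ := μ) (C := δ)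
    (f := fun ω' => (Pop^[k] G) (pst M ω) - (Pop^[k] G) (pst M ω'))
    (Eventually.of_forall fun ω' => hosc _ _)
  simpa using this


/-! ## Transfer between one- and two-sided sequences -/

/-- Extend a past to a two-sided sequence. -/
def ext2 (x : Seq1) : Seq2 := fun k => x (-k).toNat

theorem pst_ext (x : Seq1) : pst 0 (ext2 x) = x := by
  funext i; simp [pst, ext2]

theorem dep_ext {α : Type*} {f : Seq2 → α} (hf : DependsOnNonpos f) (ω : Seq2) :
    f (ext2 (pst 0 ω)) = f ω := by
  apply hf
  intro k hk
  simp only [ext2, pst]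
  congr 1
  omega

theorem pst_shift (m : ℕ) : ∀ (M : ℤ) (ω : Seq2), pst M (shift2^[m] ω) = pst (M + m) ω := by
  induction m with
  | zero => intro M ω; simp
  | succ m ih =>
    intro M ω
    rw [Function.iterate_succ_apply, ih]
    funext i
    simp only [pst, shift2]
    congr 1
    push_cast
    ring

theorem tl_pst (M : ℤ) (ω : Seq2) (n : ℕ) : tl^[n] (pst (M + n) ω) = pst M ω := by
  funext i
  rw [tl_iter]
  simp only [pst]
  congr 1
  push_cast
  ring

theorem holder_data {θ : ℝ} (hθ : θ ∈ Set.Ioo (0 : ℝ) 1) {f : Seq2 → ℝ} (hf : IsHolder2 θ f) :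
    ∃ D : ℝ, 1 ≤ D ∧ (∀ x, |f (ext2 x)| ≤ D) ∧ Hol θ D (fun x => f (ext2 x)) := by
  unfold IsHolder2 hNorm2 at hf
  rw [ENNReal.add_lt_top] at hf
  obtain ⟨h1, h2⟩ := hf
  set S := (supNorm2 f).toReal with hS
  set T := (hSemi2 θ f).toReal with hT
  have hS0 : 0 ≤ S := ENNReal.toReal_nonneg
  have hT0 : 0 ≤ T := ENNReal.toReal_nonneg
  have b : ∀ ω, |f ω| ≤ S := by
    intro ω
    have : (‖f ω‖₊ : ℝ≥0∞) ≤ supNorm2 f := le_iSup (fun ω => (‖f ω‖₊ : ℝ≥0∞)) ω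
    have := ENNReal.toReal_mono h1.ne this
    simpa using this
  have hv : ∀ N ω ω', 1 ≤ N → Agree2 N ω ω' → |f ω - f ω'| ≤ T * θ ^ N := by
    intro N ω ω' hN ha
    have l1 : (‖f ω - f ω'‖₊ : ℝ≥0∞) ≤ var2 f N :=
      le_iSup_of_le ω (le_iSup_of_le ω' (le_iSup_of_le ha le_rfl))
    have l2 : (ENNReal.ofReal θ)⁻¹ ^ N * var2 f N ≤ hSemi2 θ f :=
      le_iSup_of_le N (le_iSup_of_le hN le_rfl)
    have l3 : (ENNReal.ofReal θ)⁻¹ ^ N * (‖f ω - f ω'‖₊ : ℝ≥0∞) ≤ hSemi2 θ f :=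
      (mul_le_mul_right l1 _).trans l2
    have l4 := ENNReal.toReal_mono h2.ne l3
    rw [ENNReal.toReal_mul, ENNReal.toReal_pow, ENNReal.toReal_inv,
      ENNReal.toReal_ofReal hθ.1.le] at l4
    simp only [ENNReal.coe_toReal, coe_nnnorm, Real.norm_eq_abs] at l4
    have hpos : 0 < θ ^ N := pow_pos hθ.1 _
    rw [inv_pow, inv_mul_le_iff₀ hpos] at l4
    linarith
  refine ⟨1 + 2 * S + T, by linarith, fun x => (b _).trans (by linarith), ?_⟩
  intro N x y hxy
  rcases Nat.eq_zero_or_pos N with rfl | hN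
  · simp only [pow_zero, mul_one, Real.norm_eq_abs]
    have := abs_sub (f (ext2 x)) (f (ext2 y))
    linarith [b (ext2 x), b (ext2 y)]
  · have := hv N (ext2 x) (ext2 y) hN (by
      intro i hi
      apply hxy
      rw [abs_lt] at hi
      omega)
    rw [Real.norm_eq_abs]
    refine this.trans ?_
    apply mul_le_mul_of_nonneg_right _ (pow_nonneg hθ.1.le _)
    linarith

theorem holder_back {θ K c : ℝ} (hθ : θ ∈ Set.Ioo (0 : ℝ) 1) {H : Seq1 → ℂ}
    (hH : Hol θ K H) (hc : ∀ x, ‖H x‖ = c) : IsHolder2 θ (fun ω => H (pst 0 ω)) := by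
  unfold IsHolder2 hNorm2
  rw [ENNReal.add_lt_top]
  constructor
  · refine lt_of_le_of_lt (iSup_le fun ω => ?_) (ENNReal.ofReal_lt_top (r := c))
    rw [← hc (pst 0 ω), ofReal_norm_eq_enorm]
    rfl
  · refine lt_of_le_of_lt (iSup_le fun N => iSup_le fun hN => ?_) (ENNReal.ofReal_lt_top (r := K))
    have hv : var2 (fun ω => H (pst 0 ω)) N ≤ ENNReal.ofReal (K * θ ^ N) := by
      refine iSup_le fun ω => iSup_le fun ω' => iSup_le fun ha => ?_
      have := hH N (pst 0 ω) (pst 0 ω') (by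
        intro i hi
        apply ha
        rw [abs_lt]
        omega)
      have h2 := ENNReal.ofReal_le_ofReal this
      rw [ofReal_norm_eq_enorm] at h2
      exact h2
    have hpos : 0 < θ ^ N := pow_pos hθ.1 _
    refine (mul_le_mul_right hv _).trans ?_
    rw [← ENNReal.ofReal_inv_of_pos hθ.1, ← ENNReal.ofReal_pow (inv_nonneg.mpr hθ.1.le),
      ← ENNReal.ofReal_mul (by have := hθ.1; positivity)]
    apply ENNReal.ofReal_le_ofReal
    rw [inv_pow]
    have : (θ ^ N)⁻¹ * (K * θ ^ N) = K := by field_simp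
    exact this.le

theorem hol_cont {θ K : ℝ} (hθ : θ ∈ Set.Ioo (0 : ℝ) 1) {f : Seq1 → ℂ} (hf : Hol θ K f) :
    Continuous f := by
  rw [continuous_iff_continuousAt]
  intro x
  rw [ContinuousAt, Metric.tendsto_nhds]
  intro ε hε
  have hθt : Tendsto (fun n : ℕ => K * θ ^ n) atTop (𝓝 0) := by
    simpa using (tendsto_pow_atTop_nhds_zero_of_lt_one hθ.1.le hθ.2).const_mul K
  obtain ⟨N, hN⟩ := (hθt.eventually_lt_const hε).exists
  have h : ∀ᶠ y in 𝓝 x, ∀ i ∈ Finset.range N, y i = x i := by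
    rw [Filter.eventually_all_finset]
    intro i _
    have hc : Continuous (fun y : Seq1 => y i) := continuous_apply i
    have ho : IsOpen {y : Seq1 | y i = x i} :=
      (isOpen_discrete ({x i} : Set Bool)).preimage hc
    exact ho.mem_nhds rfl
  filter_upwards [h] with y hy
  rw [dist_eq_norm]
  exact lt_of_le_of_lt (hf N y x (fun i hi => hy i (Finset.mem_range.mpr hi))) hN

theorem tl_cont : Continuous tl := by
  unfold tl
  fun_prop

theorem ph_cont {u : Seq1 → ℂ} (hu : Continuous u) (n : ℕ) : Continuous (ph u n) := by
  induction n with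
  | zero => exact continuous_const
  | succ n ih => exact (hu.comp tl_cont).mul (ih.comp tl_cont)

theorem Xi_cont {u W : Seq1 → ℂ} (hu : Continuous u) (hW : Continuous W) (a : ℂ) (M p : ℕ) :
    Continuous (Xi a u W M p) := by
  unfold Xi Sblk
  apply Complex.continuous_re.comp
  apply continuous_const.mul
  apply ((ph_cont hu M).comp (tl_cont.iterate p)).mul
  apply continuous_finsetSum
  intro k _
  exact ((ph_cont hu k).comp (tl_cont.iterate _)).mul (hW.comp (tl_cont.iterate _))

theorem ph_bsum {β : Seq2 → ℝ} (hβ : DependsOnNonpos β) (ω : Seq2) (m : ℕ) :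
    Complex.exp (Complex.I * (bSum2 β m ω : ℝ)) =
      ph (fun x => Complex.exp (Complex.I * (β (ext2 x) : ℝ))) m (pst m ω) := by
  induction m with
  | zero => simp [bSum2, ph]
  | succ m ih =>
    have e1 : bSum2 β (m + 1) ω = β (shift2^[m] ω) + bSum2 β m ω := by
      unfold bSum2
      rw [Finset.sum_range_succ, add_comm]
    have e2 : tl (pst ((m + 1 : ℕ) : ℤ) ω) = pst m ω := by
      have := tl_pst m ω 1
      simpa using this
    have e3 : β (ext2 (pst m ω)) = β (shift2^[m] ω) := by
      rw [← dep_ext hβ (shift2^[m] ω), pst_shift, zero_add]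
    rw [ph, e2, ← ih, e1, e3, ← Complex.exp_add]
    congr 1
    push_cast
    ring

theorem Xobs_eq {β V₁ V₂ : Seq2 → ℝ} (hβ : DependsOnNonpos β) (h1 : DependsOnNonpos V₁)
    (h2 : DependsOnNonpos V₂) (α₀ : ℝ) (m : ℕ) (ω : Seq2) :
    Xobs β V₁ V₂ α₀ m ω = (Complex.exp (Complex.I * α₀) *
      (ph (fun x => Complex.exp (Complex.I * (β (ext2 x) : ℝ))) m (pst m ω) *
        (fun x => (V₁ (ext2 x) : ℂ) - Complex.I * (V₂ (ext2 x) : ℂ)) (pst m ω))).re := by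
  have e1 : V₁ (ext2 (pst m ω)) = V₁ (shift2^[m] ω) := by
    rw [← dep_ext h1 (shift2^[m] ω), pst_shift, zero_add]
  have e2 : V₂ (ext2 (pst m ω)) = V₂ (shift2^[m] ω) := by
    rw [← dep_ext h2 (shift2^[m] ω), pst_shift, zero_add]
  simp only
  rw [← ph_bsum hβ, e1, e2, ← mul_assoc, ← Complex.exp_add]
  have e3 : Complex.I * (α₀ : ℂ) + Complex.I * ((bSum2 β m ω : ℝ) : ℂ) =
      ((α₀ + bSum2 β m ω : ℝ) : ℂ) * Complex.I := by push_cast; ring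
  rw [e3, Complex.exp_mul_I, ← Complex.ofReal_cos, ← Complex.ofReal_sin]
  unfold Xobs
  generalize α₀ + bSum2 β m ω = t
  rw [Complex.mul_re]
  simp [-Complex.ofReal_cos, -Complex.ofReal_sin]

theorem xiBlock_eq {β V₁ V₂ : Seq2 → ℝ} (hβ : DependsOnNonpos β) (h1 : DependsOnNonpos V₁)
    (h2 : DependsOnNonpos V₂) (α₀ τ : ℝ) (n j : ℕ) (ω : Seq2) :
    xiBlock (Xobs β V₁ V₂ α₀) τ n j ω =
      Xi (Complex.exp (Complex.I * α₀)) (fun x => Complex.exp (Complex.I * (β (ext2 x) : ℝ)))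
        (fun x => (V₁ (ext2 x) : ℂ) - Complex.I * (V₂ (ext2 x) : ℂ))
        (j * blockP τ n + j * blockQ n) (blockP τ n)
        (pst (((j * blockP τ n + j * blockQ n : ℕ) : ℤ) + (blockP τ n : ℕ)) ω) := by
  set M := j * blockP τ n + j * blockQ n with hM
  set p := blockP τ n with hp
  unfold xiBlock Xi Sblk
  have hend : (j + 1) * blockP τ n + j * blockQ n = M + p := by rw [hM, hp]; ring
  rw [← hp, ← hM] at *
  rw [hend, Finset.mul_sum, Finset.mul_sum, Complex.re_sum]
  refine Finset.sum_nbij' (fun m => m - M) (fun k => M + k) ?_ ?_ ?_ ?_ ?_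
  · intro m hm; rw [Finset.mem_Icc] at *; omega
  · intro m hm; rw [Finset.mem_Icc] at *; omega
  · intro m hm; rw [Finset.mem_Icc] at *; omega
  · intro m hm; rw [Finset.mem_Icc] at *; omega
  · intro m hm
    rw [Finset.mem_Icc] at hm
    obtain ⟨k, rfl⟩ : ∃ k, m = M + k := ⟨m - M, by omega⟩
    have hk : k ≤ p := by omega
    rw [Xobs_eq hβ h1 h2]
    simp only [add_tsub_cancel_left]
    have e1 : tl^[p - k] (pst ((M : ℤ) + (p : ℕ)) ω) = pst ((M + k : ℕ) : ℤ) ω := by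
      rw [← tl_pst ((M + k : ℕ) : ℤ) ω (p - k)]
      congr 2
      push_cast [Nat.cast_sub hk]
      ring
    have e2 : tl^[p] (pst ((M : ℤ) + (p : ℕ)) ω) = tl^[k] (pst ((M + k : ℕ) : ℤ) ω) := by
      rw [tl_pst]
      push_cast
      rw [tl_pst]
    rw [e1, e2, ph_add]
    congr 1
    ring

theorem good_wm {θ : ℝ} (hθ : θ ∈ Set.Ioo (0 : ℝ) 1) {β : Seq2 → ℝ} (hβ : DependsOnNonpos β)
    {u : Seq1 → ℂ} {U : ℝ} {m : ℕ} (hu : ∀ x, ‖u x‖ = 1) (hU : Hol θ U u)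
    (hum : ∀ x, u x = Complex.exp (Complex.I * (m : ℂ) * (β (ext2 x) : ℂ)))
    (hwm : WM2 θ β m) : Good θ u := by
  apply good_of hθ hu hU
  intro H K c ν hc hK hHc heq
  obtain ⟨h1, h2⟩ := hwm (fun ω => H (pst 0 ω)) ν (holder_back hθ hK hHc)
    ⟨fun _ => false, by
      intro h0
      have h0' : H (pst 0 (fun _ => false)) = 0 := h0
      have := hHc (pst 0 (fun _ => false))
      rw [h0', norm_zero] at this
      linarith⟩ (by
      intro ω
      have e1 : pst 0 (shift2 ω) = cns (ω 1) (pst 0 ω) := by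
        have e2 := pst_shift 1 0 ω
        have e3 := pst_succ 0 ω
        simp only [Function.iterate_one, Nat.cast_one, zero_add] at e2 e3
        rw [e2, e3]
      rw [e1, ← heq (ω 1) (pst 0 ω), hum, dep_ext hβ])
  refine ⟨h1, fun x y => ?_⟩
  have := h2 (ext2 x) (ext2 y)
  simpa only [pst_ext] using this

theorem poly_bound {r : ℝ} (hr : r ∈ Set.Ioo (0 : ℝ) 1) :
    ∃ B : ℝ, 0 < B ∧ ∀ p : ℕ, ((p : ℝ) + 1) ^ 4 * r ^ p ≤ B := by
  have h := tendsto_pow_const_mul_const_pow_of_lt_one 4 hr.1.le hr.2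
  obtain ⟨B, hB⟩ := h.bddAbove_range
  refine ⟨max B 1 / r, div_pos (by positivity) hr.1, fun p => ?_⟩
  have := hB ⟨p + 1, rfl⟩
  simp only at this
  rw [le_div_iff₀ hr.1]
  refine le_trans ?_ (le_max_left _ _)
  push_cast at this
  calc _ = ((p : ℝ) + 1) ^ 4 * r ^ (p + 1) := by ring
    _ ≤ B := this

/-- Exponential decay of the conditional expectations of the Bernstein
blocks `ξ_j` and `ξ_j²` given the σ-algebra `F_{j-1}` generated by the coordinates
`(ω_l)_{l ≤ (j-1)p + (j-1)q}`. -/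
theorem statement16
    (θ : ℝ) (hθ : θ ∈ Set.Ioo (0 : ℝ) 1) (τ : ℝ) (hτ : τ ∈ Set.Ioo (0 : ℝ) (1 / 4))
    (μ : Measure Seq2) (hμ : IsBernoulli2 μ)
    (β : Seq2 → ℝ) (hβ : IsHolder2 θ β) (hβdep : DependsOnNonpos β)
    (V₁ V₂ : Seq2 → ℝ) (hV₁ : IsHolder2 θ V₁) (hV₂ : IsHolder2 θ V₂)
    (hV₁dep : DependsOnNonpos V₁) (hV₂dep : DependsOnNonpos V₂)
    (hWM : ∀ m ∈ ({1, 2, 4} : Set ℕ), WM2 θ β m)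
    (α₀ : ℝ) :
    ∃ C : ℝ, 0 < C ∧ ∃ r ∈ Set.Ioo (0 : ℝ) 1,
      ∀ n j : ℕ, 1 ≤ j → j ≤ blockK τ n - 1 →
        (∀ᵐ ω ∂μ,
          |(μ[fun ω' => xiBlock (Xobs β V₁ V₂ α₀) τ n j ω'|
              Falg (((j - 1 : ℕ) : ℤ) * (blockP τ n + blockQ n))]) ω -
            ∫ ω', xiBlock (Xobs β V₁ V₂ α₀) τ n j ω' ∂μ| ≤ C * r ^ blockQ n) ∧
        (∀ᵐ ω ∂μ,
          |(μ[fun ω' => (xiBlock (Xobs β V₁ V₂ α₀) τ n j ω') ^ 2|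
              Falg (((j - 1 : ℕ) : ℤ) * (blockP τ n + blockQ n))]) ω -
            ∫ ω', (xiBlock (Xobs β V₁ V₂ α₀) τ n j ω') ^ 2 ∂μ| ≤ C * r ^ blockQ n) := by
  obtain ⟨Dβ, hDβ, bβ, vβ⟩ := holder_data hθ hβ
  obtain ⟨D1, hD1, b1, v1⟩ := holder_data hθ hV₁
  obtain ⟨D2, hD2, b2, v2⟩ := holder_data hθ hV₂
  set u : Seq1 → ℂ := fun x => Complex.exp (Complex.I * (β (ext2 x) : ℝ)) with hu_def
  set W : Seq1 → ℂ := fun x => (V₁ (ext2 x) : ℂ) - Complex.I * (V₂ (ext2 x) : ℂ) with hW_def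
  set a : ℂ := Complex.exp (Complex.I * α₀) with ha_def
  set D := Dβ + D1 + D2 with hD_def
  have hD : 1 ≤ D := by linarith
  have hu : ∀ x, ‖u x‖ = 1 := fun x => by
    rw [hu_def]; simp only; rw [mul_comm]; exact Complex.norm_exp_ofReal_mul_I _
  have ha : ‖a‖ = 1 := by
    rw [ha_def, mul_comm]; exact Complex.norm_exp_ofReal_mul_I _
  have hU : Hol θ D u := by
    intro N x y hxy
    have h := vβ N x y hxy
    have e : u x - u y = u y *
        (Complex.exp (Complex.I * ((β (ext2 x) - β (ext2 y) : ℝ) : ℂ)) - 1) := by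
      rw [mul_sub, mul_one, hu_def]
      simp only
      rw [← Complex.exp_add]
      congr 2
      push_cast; ring
    rw [e, norm_mul, hu, one_mul]
    refine (Real.norm_exp_I_mul_ofReal_sub_one_le).trans (h.trans ?_)
    exact mul_le_mul_of_nonneg_right (by linarith) (pow_nonneg hθ.1.le _)
  have hW : ∀ x, ‖W x‖ ≤ D := by
    intro x
    rw [hW_def]
    refine (norm_sub_le _ _).trans ?_
    rw [norm_mul, Complex.norm_I, Complex.norm_real, Complex.norm_real, Real.norm_eq_abs,
      Real.norm_eq_abs]
    linarith [b1 x, b2 x]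
  have hWH : Hol θ D W := by
    intro N x y hxy
    have e : W x - W y = ((V₁ (ext2 x) - V₁ (ext2 y) : ℝ) : ℂ) -
        Complex.I * ((V₂ (ext2 x) - V₂ (ext2 y) : ℝ) : ℂ) := by
      rw [hW_def]; push_cast; ring
    rw [e]
    refine (norm_sub_le _ _).trans ?_
    rw [norm_mul, Complex.norm_I, Complex.norm_real, Complex.norm_real, one_mul]
    have h1 := v1 N x y hxy
    have h2 := v2 N x y hxy
    have h3 : 0 ≤ θ ^ N := pow_nonneg hθ.1.le _
    have h4 : 0 ≤ Dβ * θ ^ N := mul_nonneg (by linarith) h3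
    rw [hD_def, add_mul, add_mul]
    linarith
  have hU2 : Hol θ (2 * D ^ 2) (fun x => u x ^ 2) := by
    intro N x y hxy
    simp only [pow_two (u _)]
    exact mul_var ((hu x).le.trans hD) ((hu y).le.trans hD) (hU N x y hxy) (hU N x y hxy)
  have g1 : Good θ u := good_wm (m := 1) hθ hβdep hu hU (fun x => by simp [hu_def])
    (hWM 1 (by simp))
  have g2 : Good θ (fun x => u x ^ 2) := good_wm (m := 2) hθ hβdep
    (fun x => by rw [norm_pow, hu, one_pow]) hU2
    (fun x => by
      rw [hu_def]; simp only; rw [← Complex.exp_nat_mul]; congr 1; push_cast; ring)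
    (hWM 2 (by simp))
  obtain ⟨C, hC, r, hr, hosc⟩ := osc_main hθ hu hD hU hW hWH a ha g1 g2
  obtain ⟨B, hB, hpoly⟩ := poly_bound hr
  refine ⟨C * B, by positivity, r, hr, ?_⟩
  intro n j hj _
  obtain ⟨i, rfl⟩ : ∃ i, j = i + 1 := ⟨j - 1, by omega⟩
  have hxi := xiBlock_eq (β := β) (V₁ := V₁) (V₂ := V₂) hβdep hV₁dep hV₂dep α₀ τ n (i + 1)
  set p := blockP τ n with hp
  set q := blockQ n with hq
  have hN : (((i + 1 - 1 : ℕ) : ℤ) * ((p : ℤ) + (q : ℤ))) = ((i * (p + q) : ℕ) : ℤ) := by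
    push_cast; simp
  have hM : (i + 1) * p + (i + 1) * q = (p + q) + i * (p + q) := by ring
  rw [hM] at hxi
  have hT : ((((p + q) + i * (p + q) : ℕ) : ℤ) + (p : ℕ)) =
      ((i * (p + q) : ℕ) : ℤ) + (((p + q) + p : ℕ) : ℤ) := by push_cast; ring
  rw [hT] at hxi
  have hcont := Xi_cont (hol_cont hθ hU) (hol_cont hθ hWH) a ((p + q) + i * (p + q)) p
  have hfin : C * (p + 1) ^ 4 * r ^ (p + q) ≤ C * B * r ^ q := by
    have h1 := hpoly p
    have h2 : 0 ≤ r ^ q := pow_nonneg hr.1.le _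
    calc C * (p + 1) ^ 4 * r ^ (p + q) = C * ((p + 1) ^ 4 * r ^ p) * r ^ q := by ring
      _ ≤ C * B * r ^ q := by gcongr
  simp only [hxi]
  rw [hN]
  constructor
  · exact ce_bound hμ _ ((p + q) + p) hcont
      (fun x y => ((hosc p (p + q) (i * (p + q)) x y).1).trans hfin)
  · exact ce_bound hμ _ ((p + q) + p)
      (G := fun z => Xi a u W ((p + q) + i * (p + q)) p z ^ 2) (hcont.pow 2)
      (fun x y => ((hosc p (p + q) (i * (p + q)) x y).2).trans hfin)
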